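/- arXiv:gr-qc/0206034 — 2 statements merged into one kernel-verified Lean document; each statement's English description precedes it below -/
import Mathlib

section
/- Let n ≥ 3, k ≥ 1, α ∈ (0,1) and 0 < μ < n−2. Then the flat vector Laplacian L = −div ∘ 𝒟, mapping C^{k+1,α}_{−μ}(ℝⁿ,ℝⁿ) → C^{k−1,α}_{−μ−2}(ℝⁿ,ℝⁿ), is an isomorphism: for every vector field F ∈ C^{k−1,α}_{−μ−2}(ℝⁿ,ℝⁿ) there exists a unique vector field X ∈ C^{k+1,α}_{−μ}(ℝⁿ,ℝⁿ) with LX = F, and there is a constant C > 0, independent of F, such that ‖X‖_{k+1,α,−μ} ≤ C‖F‖_{k−1,α,−μ−2}. -/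
noncomputable section

open scoped BigOperators
open Filter MeasureTheory

/-- Euclidean space ℝⁿ. -/
abbrev Euc (n : ℕ) := EuclideanSpace ℝ (Fin n)

/-- Partial derivative ∂_j f of a scalar function. -/
def pder (n : ℕ) (f : Euc n → ℝ) (j : Fin n) (x : Euc n) : ℝ :=
  fderiv ℝ f x (EuclideanSpace.single j 1)

/-- The divergence Σ_k ∂_k X_k of a vector field. -/
def divg (n : ℕ) (X : Euc n → Euc n) (x : Euc n) : ℝ :=
  ∑ k, pder n (fun y => X y k) k x

/-- The flat conformal Killing operator:
`(𝒟X)_{jk} = ½(∂_j X_k + ∂_k X_j) − (1/n)(div X)δ_{jk}`. -/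
def confKill (n : ℕ) (X : Euc n → Euc n) (x : Euc n) (j k : Fin n) : ℝ :=
  (1/2) * (pder n (fun y => X y k) j x + pder n (fun y => X y j) k x)
    - (1/(n:ℝ)) * divg n X x * (if j = k then 1 else 0)

/-- The flat vector Laplacian `(LX)_j = −Σ_k ∂_k((𝒟X)_{jk})`. -/
def vLap (n : ℕ) (X : Euc n → Euc n) (x : Euc n) (j : Fin n) : ℝ :=
  - ∑ k, pder n (fun y => confKill n X y j k) k x

/-- The Euclidean Laplacian Δf = Σ_i ∂_i∂_i f. -/
def lap (n : ℕ) (f : Euc n → ℝ) (x : Euc n) : ℝ :=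
  ∑ i, pder n (fun y => pder n f i y) i x

/-- `WBound n k α ν C u` : the weighted Hölder norm of `u` in `C^{k,α}_{−ν}(ℝⁿ)`
is bounded by `C`; i.e. `u` is `C^k`, `(1+|x|)^{ν+|β|}|∂^β u(x)| ≤ C` for `|β| ≤ k`
(expressed via iterated Fréchet derivatives), the weighted Hölder seminorm on dyadic
annuli of the top derivatives is bounded by `C`, and so is the Hölder seminorm
of the top derivatives on the unit ball. -/
def WBound (n : ℕ) {F : Type*} [NormedAddCommGroup F] [NormedSpace ℝ F]
    (k : ℕ) (α ν C : ℝ) (u : Euc n → F) : Prop :=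
  ContDiff ℝ k u
  ∧ (∀ i : ℕ, i ≤ k → ∀ x : Euc n,
      (1 + ‖x‖) ^ (ν + i) * ‖iteratedFDeriv ℝ i u x‖ ≤ C)
  ∧ (∀ R : ℝ, 1 ≤ R → ∀ x y : Euc n,
      R ≤ ‖x‖ → ‖x‖ ≤ 2*R → R ≤ ‖y‖ → ‖y‖ ≤ 2*R → x ≠ y →
      (1 + R) ^ (ν + k + α) * ‖iteratedFDeriv ℝ k u x - iteratedFDeriv ℝ k u y‖
        ≤ C * ‖x - y‖ ^ α)
  ∧ (∀ x y : Euc n, ‖x‖ ≤ 1 → ‖y‖ ≤ 1 → x ≠ y →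
      ‖iteratedFDeriv ℝ k u x - iteratedFDeriv ℝ k u y‖ ≤ C * ‖x - y‖ ^ α)

/-- Membership in the weighted Hölder space `C^{k,α}_{−ν}(ℝⁿ)`. -/
def MemW (n : ℕ) {F : Type*} [NormedAddCommGroup F] [NormedSpace ℝ F]
    (k : ℕ) (α ν : ℝ) (u : Euc n → F) : Prop :=
  ∃ C : ℝ, WBound n k α ν C u

/-- The flat-background conformally formulated vacuum constraint system on ℝⁿ:
(i) `Δφ + ((n−2)/(4(n−1)))|𝒟W|² φ^{(−3n+2)/(n−2)} − ((n−2)/(4n)) τ² φ^{(n+2)/(n−2)} = 0`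
(ii) `LW + ((n−1)/n) φ^{2n/(n−2)} ∇τ = 0`. -/
def VacuumSystem (n : ℕ) (φ : Euc n → ℝ) (W : Euc n → Euc n) (τ : Euc n → ℝ) : Prop :=
  (∀ x : Euc n,
    lap n φ x
      + (((n:ℝ)-2)/(4*((n:ℝ)-1))) * (∑ j, ∑ k, (confKill n W x j k)^2)
          * (φ x) ^ ((-3*(n:ℝ)+2)/((n:ℝ)-2))
      - (((n:ℝ)-2)/(4*(n:ℝ))) * (τ x)^2 * (φ x) ^ (((n:ℝ)+2)/((n:ℝ)-2)) = 0)
  ∧ (∀ x : Euc n, ∀ j : Fin n,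
    vLap n W x j
      + (((n:ℝ)-1)/(n:ℝ)) * (φ x) ^ ((2*(n:ℝ))/((n:ℝ)-2)) * pder n τ j x = 0)
open scoped ContDiff Convolution Topology

/-- The average `∫ A(z) g(x - s z) dz` of `g` at scale `s` against the kernel `A`. -/
def kerAvg (n : ℕ) {E : Type*} [NormedAddCommGroup E] [NormedSpace ℝ E]
    (A : Euc n → ℝ) (s : ℝ) (g : Euc n → E) (x : Euc n) : E :=
  ∫ z, A z • g (x - s • z)

section KernelAverage

variable {n : ℕ} {E : Type*} [NormedAddCommGroup E] [NormedSpace ℝ E]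

lemma integrable_kerAvg {A : Euc n → ℝ} (hA : Continuous A) (hc : HasCompactSupport A)
    {g : Euc n → E} (hg : Continuous g) (s : ℝ) (x : Euc n) :
    Integrable (fun z => A z • g (x - s • z)) := by
  apply Continuous.integrable_of_hasCompactSupport (by fun_prop)
  exact hc.smul_right

lemma kerAvg_eq_convolution (A : Euc n → ℝ) {s : ℝ} (hs : 0 < s) (g : Euc n → E) :
    kerAvg n A s g = fun x => (s ^ n)⁻¹ •
      ((fun y => A (s⁻¹ • y)) ⋆[ContinuousLinearMap.lsmul ℝ ℝ, volume] g) x := by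
  funext x
  have h := Measure.integral_comp_smul (volume : Measure (Euc n))
    (fun y => A (s⁻¹ • y) • g (x - y)) s
  simp only [smul_smul, inv_mul_cancel₀ hs.ne', one_smul, finrank_euclideanSpace,
    Fintype.card_fin] at h
  rw [abs_of_pos (by positivity)] at h
  simpa [kerAvg, convolution_def] using h

lemma hasCompactSupport_comp_inv_smul {A : Euc n → ℝ} (hc : HasCompactSupport A) {s : ℝ}
    (hs : 0 < s) : HasCompactSupport (fun y => A (s⁻¹ • y)) :=
  hc.comp_smul (inv_ne_zero hs.ne')

lemma contDiff_kerAvg {A : Euc n → ℝ} (hA : ContDiff ℝ ∞ A) (hc : HasCompactSupport A)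
    {g : Euc n → E} (hg : Continuous g) {s : ℝ} (hs : 0 < s) :
    ContDiff ℝ ∞ (kerAvg n A s g) := by
  rw [kerAvg_eq_convolution A hs]
  apply ContDiff.const_smul
  exact (hasCompactSupport_comp_inv_smul hc hs).contDiff_convolution_left _ (n := ⊤)
    (hA.comp (contDiff_const_smul _)) hg.locallyIntegrable

lemma contDiff_pder {A : Euc n → ℝ} (hA : ContDiff ℝ ∞ A) (i : Fin n) :
    ContDiff ℝ ∞ (pder n A i) :=
  (hA.fderiv_right (m := ∞) (by simp)).clm_apply contDiff_const

lemma tsupport_pder_subset (A : Euc n → ℝ) (i : Fin n) :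
    tsupport (pder n A i) ⊆ tsupport A := by
  refine (closure_mono ?_).trans (tsupport_fderiv_subset ℝ (f := A))
  intro z hz
  simp only [Function.mem_support, pder] at hz ⊢
  intro h
  simp [h] at hz

lemma hasCompactSupport_pder {A : Euc n → ℝ} (hc : HasCompactSupport A) (i : Fin n) :
    HasCompactSupport (pder n A i) :=
  hc.mono' ((subset_tsupport _).trans (tsupport_pder_subset A i))

/-- Differentiating an average through its kernel. -/
lemma fderiv_kerAvg_kernel {A : Euc n → ℝ} (hA : ContDiff ℝ ∞ A) (hc : HasCompactSupport A)
    {g : Euc n → E} (hg : Continuous g) {s : ℝ} (hs : 0 < s) (x : Euc n) (i : Fin n) :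
    fderiv ℝ (kerAvg n A s g) x (EuclideanSpace.single i 1)
      = s⁻¹ • kerAvg n (pder n A i) s g x := by
  have hc' := hasCompactSupport_comp_inv_smul hc hs
  have hA' : ContDiff ℝ 1 (fun y => A (s⁻¹ • y)) :=
    (hA.comp (contDiff_const_smul _)).of_le (by simp)
  have h := (hc'.hasFDerivAt_convolution_left (ContinuousLinearMap.lsmul ℝ ℝ)
    (μ := volume) hA' hg.locallyIntegrable x).const_smul ((s ^ n)⁻¹)
  rw [kerAvg_eq_convolution A hs, kerAvg_eq_convolution _ hs]
  erw [h.fderiv]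
  have hd : ∀ y, fderiv ℝ (fun y => A (s⁻¹ • y)) y = s⁻¹ • fderiv ℝ A (s⁻¹ • y) := by
    intro y
    have h1 : HasFDerivAt (fun y : Euc n => s⁻¹ • y) (s⁻¹ • ContinuousLinearMap.id ℝ (Euc n)) y :=
      (hasFDerivAt_id y).const_smul s⁻¹
    have h2 := ((hA.differentiable (by simp)) (s⁻¹ • y)).hasFDerivAt.comp y h1
    erw [h2.fderiv]
    ext v
    simp
  have hint := (hc'.fderiv ℝ).convolutionExists_left
    ((ContinuousLinearMap.lsmul ℝ ℝ : ℝ →L[ℝ] E →L[ℝ] E).precompL (Euc n)) (μ := volume)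
    (hA'.continuous_fderiv one_ne_zero) hg.locallyIntegrable x
  simp only [smul_apply, convolution_def]
  rw [ContinuousLinearMap.integral_apply hint, smul_comm]
  congr 1
  rw [← integral_smul]
  congr 1
  funext y
  simp [hd, pder]

lemma fderiv_kerAvg_eq_sum {A : Euc n → ℝ} (hA : ContDiff ℝ ∞ A) (hc : HasCompactSupport A)
    {g : Euc n → E} (hg : Continuous g) {s : ℝ} (hs : 0 < s) :
    fderiv ℝ (kerAvg n A s g) = fun x => ∑ i, s⁻¹ •
      ContinuousLinearMap.smulRightL ℝ (Euc n) E (EuclideanSpace.proj i)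
        (kerAvg n (pder n A i) s g x) := by
  funext x
  ext v
  conv_lhs => rw [← (EuclideanSpace.basisFun (Fin n) ℝ).sum_repr v]
  simp only [map_sum, map_smul, EuclideanSpace.basisFun_apply, fderiv_kerAvg_kernel hA hc hg hs,
    EuclideanSpace.basisFun_repr]
  rw [sum_apply]
  refine Finset.sum_congr rfl fun i _ => ?_
  rw [smul_apply, ContinuousLinearMap.smulRightL_apply_apply, smul_comm]
  rfl

lemma exists_isometry_iteratedFDeriv_succ (V F : Type*) [NormedAddCommGroup V]
    [NormedSpace ℝ V] [NormedAddCommGroup F] [NormedSpace ℝ F] (m : ℕ) :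
    ∃ e : (V →L[ℝ] (V [×m]→L[ℝ] F)) ≃ₗᵢ[ℝ] (V [×(m + 1)]→L[ℝ] F),
      ∀ f : V → F, iteratedFDeriv ℝ (m + 1) f = e ∘ fderiv ℝ (iteratedFDeriv ℝ m f) :=
  ⟨(continuousMultilinearCurryLeftEquiv ℝ (fun _ : Fin (m + 1) => V) F).symm,
    fun _ => iteratedFDeriv_succ_eq_comp_left⟩

lemma norm_iteratedFDeriv_iteratedFDeriv_add {V F : Type*} [NormedAddCommGroup V]
    [NormedSpace ℝ V] [NormedAddCommGroup F] [NormedSpace ℝ F] (u : V → F) (m : ℕ) :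
    ∀ (q : ℕ) (x : V),
      ‖iteratedFDeriv ℝ q (iteratedFDeriv ℝ m u) x‖ = ‖iteratedFDeriv ℝ (m + q) u x‖ := by
  induction m with
  | zero =>
    intro q x
    rw [iteratedFDeriv_zero_eq_comp, LinearIsometryEquiv.norm_iteratedFDeriv_comp_left, zero_add]
  | succ m ih =>
    intro q x
    obtain ⟨e, he⟩ := exists_isometry_iteratedFDeriv_succ V F m
    rw [he, LinearIsometryEquiv.norm_iteratedFDeriv_comp_left (𝕜 := ℝ)
      (F := V →L[ℝ] (V [×m]→L[ℝ] F)) (G := V [×(m + 1)]→L[ℝ] F) e,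
      norm_iteratedFDeriv_fderiv, ih, add_right_comm, add_assoc]

/-- Derivatives of an average at scale `s` cost powers of `s⁻¹`. -/
lemma exists_norm_iteratedFDeriv_kerAvg_le (r : ℝ) (q : ℕ) :
    ∀ A : Euc n → ℝ, ContDiff ℝ ∞ A → tsupport A ⊆ Metric.closedBall 0 r →
    ∃ C : ℝ, 0 ≤ C ∧ ∀ (g : Euc n → E), Continuous g → ∀ s : ℝ, 0 < s → ∀ x : Euc n,
      ‖iteratedFDeriv ℝ q (kerAvg n A s g) x‖
        ≤ C * (s⁻¹) ^ q * ∫ z in Metric.closedBall 0 r, ‖g (x - s • z)‖ := by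
  induction q with
  | zero =>
    intro A hA hr
    have hc : HasCompactSupport A :=
      (isCompact_closedBall 0 r).of_isClosed_subset (isClosed_tsupport A) hr
    obtain ⟨C, hC⟩ := hc.exists_bound_of_continuous hA.continuous
    have hC0 : 0 ≤ C := (norm_nonneg _).trans (hC 0)
    refine ⟨C, hC0, fun g hg s hs x => ?_⟩
    rw [norm_iteratedFDeriv_zero, pow_zero, mul_one, ← integral_const_mul, kerAvg,
      ← setIntegral_eq_integral_of_forall_compl_eq_zero (s := Metric.closedBall 0 r)]
    · apply norm_integral_le_of_norm_le
      · exact (Continuous.continuousOn (by fun_prop)).integrableOn_compact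
          (isCompact_closedBall 0 r)
      · refine Eventually.of_forall fun z => ?_
        rw [norm_smul]
        exact mul_le_mul_of_nonneg_right (hC z) (norm_nonneg _)
    · intro z hz
      rw [image_eq_zero_of_notMem_tsupport (fun h => hz (hr h)), zero_smul]
  | succ q ih =>
    intro A hA hr
    have hc : HasCompactSupport A :=
      (isCompact_closedBall 0 r).of_isClosed_subset (isClosed_tsupport A) hr
    choose C hC0 hC using fun i : Fin n => ih (pder n A i) (contDiff_pder hA i)
      ((tsupport_pder_subset A i).trans hr)
    let T : Fin n → E →L[ℝ] (Euc n →L[ℝ] E) := fun i =>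
      ContinuousLinearMap.smulRightL ℝ (Euc n) E (EuclideanSpace.proj i)
    refine ⟨∑ i, ‖T i‖ * C i, Finset.sum_nonneg fun i _ => mul_nonneg (norm_nonneg (T i)) (hC0 i),
      fun g hg s hs x => ?_⟩
    have hd : ∀ i : Fin n, ContDiff ℝ ∞ (kerAvg n (pder n A i) s g) := fun i =>
      contDiff_kerAvg (contDiff_pder hA i) (hasCompactSupport_pder hc i) hg hs
    rw [← norm_iteratedFDeriv_fderiv, fderiv_kerAvg_eq_sum hA hc hg hs]
    have hq : (q : WithTop ℕ∞) ≤ ∞ := by exact_mod_cast le_top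
    have hT : ∀ i, ContDiff ℝ ∞ (fun x => T i (kerAvg n (pder n A i) s g x)) := fun i =>
      (T i).contDiff.comp (hd i)
    rw [iteratedFDeriv_fun_sum_apply (fun i _ => (((hT i).const_smul _).of_le hq).contDiffAt)]
    refine (norm_sum_le _ _).trans ?_
    rw [Finset.sum_mul, Finset.sum_mul]
    refine Finset.sum_le_sum fun i _ => ?_
    have h1 : iteratedFDeriv ℝ q (fun x => s⁻¹ • T i (kerAvg n (pder n A i) s g x)) x
        = s⁻¹ • iteratedFDeriv ℝ q (fun x => T i (kerAvg n (pder n A i) s g x)) x :=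
      iteratedFDeriv_const_smul_apply' (((hT i).of_le hq).contDiffAt)
    have h2 := (T i).iteratedFDeriv_comp_left (((hd i).of_le hq).contDiffAt (x := x)) le_rfl
    erw [h1]
    rw [norm_smul, Real.norm_of_nonneg (inv_nonneg.2 hs.le)]
    erw [h2]
    have h3 := (T i).norm_compContinuousMultilinearMap_le
      (iteratedFDeriv ℝ q (kerAvg n (pder n A i) s g) x)
    calc _ ≤ s⁻¹ * (‖T i‖ * (C i * (s⁻¹) ^ q *
          ∫ z in Metric.closedBall 0 r, ‖g (x - s • z)‖)) := by
            gcongr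
            exact h3.trans (by gcongr; exact hC i g hg s hs x)
      _ = _ := by ring

/-- Differentiating an average through the averaged function. -/
lemma hasFDerivAt_kerAvg {A : Euc n → ℝ} (hA : Continuous A) (hc : HasCompactSupport A)
    {g : Euc n → E} (hg : ContDiff ℝ 1 g) (s : ℝ) (x : Euc n) :
    HasFDerivAt (kerAvg n A s g) (kerAvg n A s (fderiv ℝ g) x) x := by
  have hg' := hg.continuous_fderiv one_ne_zero
  have hK : IsCompact ((fun p : Euc n × Euc n => p.1 - s • p.2) ''
      (Metric.closedBall x 1 ×ˢ tsupport A)) :=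
    ((isCompact_closedBall x 1).prod hc.isCompact).image (by fun_prop)
  obtain ⟨C, hC⟩ := hK.exists_bound_of_continuousOn hg'.continuousOn
  refine hasFDerivAt_integral_of_dominated_of_fderiv_le (bound := fun z => |A z| * C)
    (F' := fun x z => A z • fderiv ℝ g (x - s • z))
    (Metric.closedBall_mem_nhds x one_pos) ?_ ?_ ?_ ?_ ?_ ?_
  · exact Eventually.of_forall fun y =>
      (integrable_kerAvg hA hc hg.continuous s y).aestronglyMeasurable
  · exact integrable_kerAvg hA hc hg.continuous s x
  · exact (integrable_kerAvg hA hc hg' s x).aestronglyMeasurable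
  · refine Eventually.of_forall fun z y hy => ?_
    rw [norm_smul, Real.norm_eq_abs]
    by_cases hz : z ∈ tsupport A
    · exact mul_le_mul_of_nonneg_left (hC _ ⟨(y, z), ⟨hy, hz⟩, rfl⟩) (abs_nonneg _)
    · simp [image_eq_zero_of_notMem_tsupport hz]
  · exact Integrable.mul_const (hA.integrable_of_hasCompactSupport hc).abs C
  · refine Eventually.of_forall fun z y _ => ?_
    have h1 : HasFDerivAt (fun y : Euc n => y - s • z) (ContinuousLinearMap.id ℝ _) y :=
      (hasFDerivAt_id y).sub_const _
    have h2 := ((hg.differentiable one_ne_zero) (y - s • z)).hasFDerivAt.comp y h1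
    rw [ContinuousLinearMap.comp_id] at h2
    exact h2.const_smul (A z)

lemma iteratedFDeriv_kerAvg {A : Euc n → ℝ} (hA : Continuous A) (hc : HasCompactSupport A)
    (s : ℝ) (m : ℕ) {f : Euc n → E} (hf : ContDiff ℝ m f) :
    iteratedFDeriv ℝ m (kerAvg n A s f) = kerAvg n A s (iteratedFDeriv ℝ m f) := by
  induction m with
  | zero =>
    funext x
    simp only [iteratedFDeriv_zero_eq_comp, kerAvg, Function.comp_apply]
    have h := (continuousMultilinearCurryFin0 ℝ (Euc n)
      E).symm.toContinuousLinearEquiv.integral_comp_comm (μ := volume)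
      (fun z => A z • f (x - s • z))
    simp only [map_smul] at h
    exact h.symm
  | succ m ih =>
    funext x
    obtain ⟨e, he⟩ := exists_isometry_iteratedFDeriv_succ (Euc n) E m
    rw [he, he, ih (hf.of_le (by norm_cast; omega)), Function.comp_apply, (hasFDerivAt_kerAvg hA hc
        (hf.iteratedFDeriv_right (m := 1) (by norm_cast; omega)) s x).fderiv]
    simp only [kerAvg, Function.comp_apply]
    have h := ContinuousLinearEquiv.integral_comp_comm (𝕜 := ℝ) (μ := volume)
      (E := Euc n →L[ℝ] (Euc n [×m]→L[ℝ] E)) (F := Euc n [×(m + 1)]→L[ℝ] E)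
      e.toContinuousLinearEquiv
      (fun z => A z • fderiv ℝ (iteratedFDeriv ℝ m f) (x - s • z))
    simp only [map_smul] at h
    exact h.symm

end KernelAverage

section WeightedBounds

/-- Dyadic sums of terms growing like `(2^j/W)^a` below the scale `W` and decaying like
`(2^j/W)^(-b)` above it are bounded uniformly in `W`. -/
lemma exists_dyadic_sum_le {a b : ℝ} (ha : 0 < a) (hb : 0 < b) :
    ∃ C : ℝ, 0 ≤ C ∧ ∀ (W B : ℝ) (t : ℤ → ℝ), 0 < W → 0 ≤ B → (∀ j, 0 ≤ t j) →
      (∀ j, t j ≤ B * ((2:ℝ) ^ j / W) ^ a) → (∀ j, t j ≤ B * ((2:ℝ) ^ j / W) ^ (-b)) →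
      Summable t ∧ ∑' j, t j ≤ C * B := by
  set ρ : ℝ := (2:ℝ) ^ (-min a b) with hρ
  have hmin : 0 < min a b := lt_min ha hb
  have hρ0 : 0 ≤ ρ := by positivity
  have hρ1 : ρ < 1 := Real.rpow_lt_one_of_one_lt_of_neg one_lt_two (by linarith)
  have hsum : Summable fun i : ℤ => (2:ℝ) ^ b * ρ ^ i.natAbs := by
    apply Summable.mul_left
    apply Summable.of_nat_of_neg <;> simpa using summable_geometric_of_lt_one hρ0 hρ1
  refine ⟨∑' i : ℤ, (2:ℝ) ^ b * ρ ^ i.natAbs, tsum_nonneg fun i => by positivity, ?_⟩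
  intro W B t hW hB ht0 hta htb
  set j₀ := Int.log 2 W
  have h1 : (2:ℝ) ^ j₀ ≤ W := by
    simpa using Int.zpow_log_le_self (b := 2) (by norm_num) hW
  have h2 : W < (2:ℝ) ^ j₀ * 2 := by
    have := Int.lt_zpow_succ_log_self (b := 2) (by norm_num) W
    rwa [zpow_add_one₀ (by norm_num)] at this
  have hp : (0:ℝ) < 2 ^ j₀ := by positivity
  have key : ∀ i : ℤ, t (j₀ + i) ≤ B * ((2:ℝ) ^ b * ρ ^ i.natAbs) := by
    intro i
    have hq : (2:ℝ) ^ (j₀ + i) / W = (2:ℝ) ^ i * (2 ^ j₀ / W) := by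
      rw [zpow_add₀ (by norm_num)]; ring
    have hpi : (0:ℝ) < 2 ^ i := by positivity
    have hb1 : (1:ℝ) ≤ 2 ^ b := Real.one_le_rpow (by norm_num) hb.le
    rcases le_total 0 i with hi | hi
    · refine (htb _).trans (mul_le_mul_of_nonneg_left ?_ hB)
      rw [hq, Real.mul_rpow hpi.le (by positivity), mul_comm]
      have h3 : ((2:ℝ) ^ j₀ / W) ^ (-b) ≤ 2 ^ b := by
        rw [Real.rpow_neg (by positivity), ← Real.inv_rpow (by positivity), inv_div]
        exact Real.rpow_le_rpow (by positivity) ((div_le_iff₀ hp).2 (by linarith)) hb.le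
      have h4 : ((2:ℝ) ^ i) ^ (-b) ≤ ρ ^ i.natAbs := by
        obtain ⟨m, rfl⟩ := Int.eq_ofNat_of_zero_le hi
        simp only [zpow_natCast, Int.natAbs_natCast]
        rw [hρ, ← Real.rpow_natCast, ← Real.rpow_natCast, ← Real.rpow_mul (by norm_num),
          ← Real.rpow_mul (by norm_num)]
        apply Real.rpow_le_rpow_of_exponent_le (by norm_num)
        have : min a b ≤ b := min_le_right _ _
        nlinarith [(Nat.cast_nonneg m : (0:ℝ) ≤ m)]
      exact mul_le_mul h3 h4 (by positivity) (by positivity)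
    · refine (hta _).trans (mul_le_mul_of_nonneg_left ?_ hB)
      have h3 : ((2:ℝ) ^ (j₀ + i) / W) ^ a ≤ ((2:ℝ) ^ i) ^ a := by
        apply Real.rpow_le_rpow (by positivity) _ ha.le
        rw [hq]
        exact mul_le_of_le_one_right hpi.le ((div_le_one hW).2 h1)
      have h4 : ((2:ℝ) ^ i) ^ a ≤ ρ ^ i.natAbs := by
        obtain ⟨m, hm⟩ := Int.eq_ofNat_of_zero_le (neg_nonneg.2 hi)
        obtain rfl : i = -(m : ℤ) := by omega
        simp only [zpow_neg, zpow_natCast, Int.natAbs_neg, Int.natAbs_natCast]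
        rw [hρ, ← Real.rpow_natCast, ← Real.rpow_natCast, ← Real.rpow_neg (by norm_num),
          ← Real.rpow_mul (by norm_num), ← Real.rpow_mul (by norm_num)]
        apply Real.rpow_le_rpow_of_exponent_le (by norm_num)
        have : min a b ≤ a := min_le_left _ _
        nlinarith [(Nat.cast_nonneg m : (0:ℝ) ≤ m)]
      exact (h3.trans h4).trans (le_mul_of_one_le_left (by positivity) hb1)
  have hs' : Summable fun i => t (j₀ + i) :=
    (hsum.mul_left B).of_nonneg_of_le (fun i => ht0 _) key
  have hs : Summable t := ((Equiv.addLeft j₀).summable_iff (f := t)).1 hs'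
  refine ⟨hs, ?_⟩
  rw [← (Equiv.addLeft j₀).tsum_eq t, mul_comm, ← tsum_mul_left]
  exact hs'.tsum_le_tsum key (hsum.mul_left B)

variable {n : ℕ} {E : Type*} [NormedAddCommGroup E]

lemma integrableOn_norm_rpow_neg (hn : 1 ≤ n) {ν : ℝ} (hν : ν < n) :
    IntegrableOn (fun y : Euc n => ‖y‖ ^ (-ν)) (Metric.ball 0 1) := by
  have : Nonempty (Fin n) := ⟨⟨0, hn⟩⟩
  rw [integrableOn_fun_norm_addHaar (volume : Measure (Euc n)) (f := fun y : ℝ => y ^ (-ν))]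
  have h := (intervalIntegral.integrableOn_Ioo_rpow_iff (s := n - 1 - ν) one_pos).2 (by linarith)
  refine h.congr_fun (fun y hy => ?_) measurableSet_Ioo
  rw [finrank_euclideanSpace, Fintype.card_fin, smul_eq_mul, ← Real.rpow_natCast,
    ← Real.rpow_add hy.1, Nat.cast_sub hn, Nat.cast_one, sub_eq_add_neg]

/-- Averages of functions decaying like `|x|^(-ν)`, `0 ≤ ν < n`, decay in the scale. -/
lemma exists_integral_norm_comp_le (hn : 1 ≤ n) (r : ℝ) {ν : ℝ} (hν0 : 0 ≤ ν) (hν : ν < n) :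
    ∃ C : ℝ, 0 ≤ C ∧ ∀ (g : Euc n → E) (M : ℝ), Continuous g → 0 ≤ M →
      (∀ y, ‖g y‖ ≤ M * (1 + ‖y‖) ^ (-ν)) → ∀ s : ℝ, 0 < s → ∀ x : Euc n,
      ∫ z in Metric.closedBall 0 r, ‖g (x - s • z)‖ ≤ C * M * s ^ (-ν) := by
  set φ : Euc n → ℝ := (Metric.ball 0 1).indicator (fun y => ‖y‖ ^ (-ν)) with hφ
  have hφi : Integrable φ :=
    (integrable_indicator_iff measurableSet_ball).2 (integrableOn_norm_rpow_neg hn hν)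
  have hφ0 : ∀ y, 0 ≤ φ y := fun y => Set.indicator_nonneg (fun _ _ => by positivity) y
  set V : ℝ := volume.real (Metric.closedBall (0 : Euc n) r)
  refine ⟨(∫ y, φ y) + V, add_nonneg (integral_nonneg hφ0) measureReal_nonneg, ?_⟩
  intro g M hg hM hgM s hs x
  have : Nonempty (Fin n) := ⟨⟨0, hn⟩⟩
  have hpt : ∀ᵐ z ∂(volume.restrict (Metric.closedBall (0 : Euc n) r)),
      ‖g (x - s • z)‖ ≤ M * s ^ (-ν) * (φ (s⁻¹ • x - z) + 1) := by
    apply ae_restrict_of_ae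
    filter_upwards [Measure.ae_ne volume (s⁻¹ • x)] with z hz
    have hxz : x - s • z = s • (s⁻¹ • x - z) := by
      rw [smul_sub, smul_smul, mul_inv_cancel₀ hs.ne', one_smul]
    set y := s⁻¹ • x - z
    have hy : 0 < ‖y‖ := norm_pos_iff.2 (sub_ne_zero.2 hz.symm)
    have h1 : (1 + ‖x - s • z‖) ^ (-ν) ≤ s ^ (-ν) * ‖y‖ ^ (-ν) := by
      rw [hxz, norm_smul, Real.norm_of_nonneg hs.le, ← Real.mul_rpow hs.le hy.le]
      exact Real.rpow_le_rpow_of_nonpos (by positivity) (by linarith) (by linarith)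
    have h2 : ‖y‖ ^ (-ν) ≤ φ y + 1 := by
      by_cases hb : y ∈ Metric.ball (0 : Euc n) 1
      · rw [hφ, Set.indicator_of_mem hb]; linarith
      · have : ‖y‖ ^ (-ν) ≤ 1 :=
          Real.rpow_le_one_of_one_le_of_nonpos (by simpa using hb) (by linarith)
        linarith [hφ0 y]
    calc _ ≤ M * (1 + ‖x - s • z‖) ^ (-ν) := hgM _
      _ ≤ M * (s ^ (-ν) * (φ y + 1)) := by
        gcongr
        exact h1.trans (by gcongr)
      _ = _ := by ring
  have hφs : Integrable (fun z => φ (s⁻¹ • x - z)) := hφi.comp_sub_left _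
  have hfin : IntegrableOn (fun _ : Euc n => (1:ℝ)) (Metric.closedBall 0 r) :=
    continuousOn_const.integrableOn_compact (isCompact_closedBall 0 r)
  have hsplit : ∫ z in Metric.closedBall (0 : Euc n) r, (φ (s⁻¹ • x - z) + 1)
      ≤ (∫ y, φ y) + V := by
    rw [integral_add hφs.integrableOn hfin]
    gcongr
    · rw [← integral_sub_left_eq_self φ volume (s⁻¹ • x)]
      exact setIntegral_le_integral hφs (Eventually.of_forall fun z => hφ0 _)
    · simp [V]
  calc ∫ z in Metric.closedBall 0 r, ‖g (x - s • z)‖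
      ≤ ∫ z in Metric.closedBall 0 r, M * s ^ (-ν) * (φ (s⁻¹ • x - z) + 1) := by
        apply integral_mono_ae _ _ hpt
        · exact (Continuous.continuousOn (by fun_prop)).integrableOn_compact
            (isCompact_closedBall 0 r)
        · exact (hφs.integrableOn.add hfin).const_mul _
    _ = M * s ^ (-ν) * ∫ z in Metric.closedBall (0 : Euc n) r, (φ (s⁻¹ • x - z) + 1) :=
        integral_const_mul _ _
    _ ≤ M * s ^ (-ν) * ((∫ y, φ y) + V) := by gcongr
    _ = _ := by ring

end WeightedBounds

/-- A form of `WBound` in which the weighted Hölder seminorm is taken over all pairs of points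
that are close relative to their distance to the origin. -/
def HolderDecay (n : ℕ) {E : Type*} [NormedAddCommGroup E] [NormedSpace ℝ E]
    (m : ℕ) (α ν M : ℝ) (f : Euc n → E) : Prop :=
  ContDiff ℝ m f
  ∧ (∀ i : ℕ, i ≤ m → ∀ x : Euc n, ‖iteratedFDeriv ℝ i f x‖ ≤ M * (1 + ‖x‖) ^ (-(ν + i)))
  ∧ (∀ x y : Euc n, ‖x - y‖ ≤ (1 + ‖x‖) / 4 →
      ‖iteratedFDeriv ℝ m f x - iteratedFDeriv ℝ m f y‖
        ≤ M * (1 + ‖x‖) ^ (-(ν + m + α)) * ‖x - y‖ ^ α)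

section Equivalence

variable {n : ℕ} {E : Type*} [NormedAddCommGroup E] [NormedSpace ℝ E]

lemma HolderDecay.nonneg {m : ℕ} {α ν M : ℝ} {f : Euc n → E} (hf : HolderDecay n m α ν M f) :
    0 ≤ M := by
  have h := (norm_nonneg _).trans (hf.2.1 0 (Nat.zero_le _) 0)
  simpa using h

lemma WBound.nonneg {m : ℕ} {α ν C : ℝ} {f : Euc n → E} (hf : WBound n m α ν C f) : 0 ≤ C := by
  have h := hf.2.1 0 (Nat.zero_le _) 0
  simp only [norm_zero, add_zero, Real.one_rpow, one_mul] at h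
  exact (norm_nonneg _).trans h

lemma le_mul_rpow_neg {w p a b : ℝ} (hw : 0 < w) (h : w ^ p * a ≤ b) : a ≤ b * w ^ (-p) := by
  rw [Real.rpow_neg hw.le, ← div_eq_mul_inv, le_div_iff₀ (by positivity)]
  linarith

lemma WBound.holderDecay {m : ℕ} {α ν C : ℝ} (hα : 0 < α) (hν : 0 ≤ ν) {f : Euc n → E}
    (hf : WBound n m α ν C f) : HolderDecay n m α ν (2 * 4 ^ (ν + m + α) * C) f := by
  have hC := hf.nonneg
  obtain ⟨h1, h2, h3, h4⟩ := hf
  set p := ν + m + α with hp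
  have hp0 : 0 < p := by positivity
  have hK : (1:ℝ) ≤ 4 ^ p := Real.one_le_rpow (by norm_num) hp0.le
  refine ⟨h1, fun i hi x => ?_, ?_⟩
  · refine (le_mul_rpow_neg (by positivity) (h2 i hi x)).trans ?_
    gcongr
    nlinarith
  · set D := iteratedFDeriv ℝ m f
    have inner : ∀ (v : ℝ) (a b : Euc n), 0 < v → v ≤ 4 → ‖a‖ ≤ 1 → ‖b‖ ≤ 1 →
        ‖D a - D b‖ ≤ 4 ^ p * C * v ^ (-p) * ‖a - b‖ ^ α := by
      intro v a b hv hv4 ha hb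
      rcases eq_or_ne a b with rfl | hab
      · simp only [sub_self, norm_zero]; positivity
      have h5 : (1:ℝ) ≤ 4 ^ p * v ^ (-p) := by
        rw [Real.rpow_neg hv.le, ← div_eq_mul_inv, one_le_div (by positivity)]
        exact Real.rpow_le_rpow hv.le hv4 hp0.le
      calc _ ≤ C * ‖a - b‖ ^ α := h4 a b ha hb hab
        _ ≤ (4 ^ p * v ^ (-p)) * (C * ‖a - b‖ ^ α) :=
          le_mul_of_one_le_left (by positivity) h5
        _ = _ := by ring
    have outer : ∀ (v : ℝ) (a b : Euc n), 0 < v → v ≤ 4 * (1 + ‖a‖) → v ≤ 4 * (1 + ‖b‖) →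
        1 ≤ ‖a‖ → 1 ≤ ‖b‖ → ‖a‖ ≤ 2 * ‖b‖ → ‖b‖ ≤ 2 * ‖a‖ →
        ‖D a - D b‖ ≤ 4 ^ p * C * v ^ (-p) * ‖a - b‖ ^ α := by
      intro v a b hv hva hvb ha hb hab hba
      rcases eq_or_ne a b with rfl | hne
      · simp only [sub_self, norm_zero]; positivity
      set R := min ‖a‖ ‖b‖ with hR
      have hR1 : 1 ≤ R := le_min ha hb
      have hvR : v ≤ 4 * (1 + R) := by
        rcases min_choice ‖a‖ ‖b‖ with h | h <;> rw [hR, h] <;> assumption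
      have ha2 : ‖a‖ ≤ 2 * R := by
        rcases min_choice ‖a‖ ‖b‖ with h | h <;> rw [hR, h] <;> linarith
      have hb2 : ‖b‖ ≤ 2 * R := by
        rcases min_choice ‖a‖ ‖b‖ with h | h <;> rw [hR, h] <;> linarith
      have h5 := le_mul_rpow_neg (by positivity)
        (h3 R hR1 a b (min_le_left _ _) ha2 (min_le_right _ _) hb2 hne)
      have h6 : (1 + R) ^ (-p) ≤ 4 ^ p * v ^ (-p) := by
        have : (1 + R) ^ (-p) ≤ (v / 4) ^ (-p) :=
          Real.rpow_le_rpow_of_nonpos (by positivity) (by linarith) (by linarith)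
        refine this.trans_eq ?_
        rw [Real.div_rpow hv.le (by norm_num), Real.rpow_neg (by norm_num : (0:ℝ) ≤ 4) p,
          div_inv_eq_mul, mul_comm]
      calc _ ≤ C * ‖a - b‖ ^ α * (1 + R) ^ (-p) := h5
        _ ≤ C * ‖a - b‖ ^ α * (4 ^ p * v ^ (-p)) := by gcongr
        _ = _ := by ring
    intro x y hxy
    have hw : 0 < 1 + ‖x‖ := by positivity
    have e1 : ‖x‖ ≤ ‖y‖ + ‖x - y‖ := by
      have := norm_add_le y (x - y); simpa using this
    have e2 : ‖y‖ ≤ ‖x‖ + ‖x - y‖ := by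
      have := norm_sub_le x (x - y); simpa using this
    have hseg : ∀ z ∈ segment ℝ x y, ‖x - z‖ ≤ ‖x - y‖ ∧ ‖z - y‖ ≤ ‖x - y‖ := by
      intro z hz
      have := dist_add_dist_of_mem_segment hz
      simp only [dist_eq_norm] at this
      constructor <;> nlinarith [norm_nonneg (x - z), norm_nonneg (z - y)]
    have combine : ∀ z ∈ segment ℝ x y,
        ‖D x - D z‖ ≤ 4 ^ p * C * (1 + ‖x‖) ^ (-p) * ‖x - z‖ ^ α →
        ‖D z - D y‖ ≤ 4 ^ p * C * (1 + ‖x‖) ^ (-p) * ‖z - y‖ ^ α →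
        ‖D x - D y‖ ≤ 2 * 4 ^ p * C * (1 + ‖x‖) ^ (-p) * ‖x - y‖ ^ α := by
      intro z hz hxz hzy
      obtain ⟨g1, g2⟩ := hseg z hz
      calc _ ≤ ‖D x - D z‖ + ‖D z - D y‖ := norm_sub_le_norm_sub_add_norm_sub _ _ _
        _ ≤ 4 ^ p * C * (1 + ‖x‖) ^ (-p) * ‖x - y‖ ^ α
            + 4 ^ p * C * (1 + ‖x‖) ^ (-p) * ‖x - y‖ ^ α := by
          refine add_le_add (hxz.trans ?_) (hzy.trans ?_) <;> gcongr
        _ = _ := by ring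
    rcases le_total ‖x‖ 1 with hx | hx <;> rcases le_total ‖y‖ 1 with hy | hy
    · exact combine y (right_mem_segment ℝ x y) (inner _ x y hw (by linarith) hx hy)
        (by simp only [sub_self, norm_zero]; positivity)
    · obtain ⟨z, hz, hz1⟩ := (convex_segment x y).isPreconnected.intermediate_value
        (left_mem_segment ℝ x y) (right_mem_segment ℝ x y) continuous_norm.continuousOn
        (⟨hx, hy⟩ : (1:ℝ) ∈ Set.Icc ‖x‖ ‖y‖)
      refine combine z hz (inner _ x z hw (by linarith) hx hz1.le)
        (outer _ z y hw ?_ ?_ ?_ ?_ ?_ ?_) <;> linarith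
    · obtain ⟨z, hz, hz1⟩ := (convex_segment x y).isPreconnected.intermediate_value
        (right_mem_segment ℝ x y) (left_mem_segment ℝ x y) continuous_norm.continuousOn
        (⟨hy, hx⟩ : (1:ℝ) ∈ Set.Icc ‖y‖ ‖x‖)
      refine combine z hz (outer _ x z hw ?_ ?_ ?_ ?_ ?_ ?_)
        (inner _ z y hw (by linarith) hz1.le hy) <;> linarith
    · refine combine y (right_mem_segment ℝ x y) (outer _ x y hw ?_ ?_ ?_ ?_ ?_ ?_)
        (by simp only [sub_self, norm_zero]; positivity) <;> linarith

lemma HolderDecay.wBound {m : ℕ} {α ν M : ℝ} (hα : 0 < α) (hν : 0 ≤ ν) {f : Euc n → E}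
    (hf : HolderDecay n m α ν M f) : WBound n m α ν (2 * 4 ^ α * M) f := by
  have hM := hf.nonneg
  obtain ⟨h1, h2, h3⟩ := hf
  have hK : (1:ℝ) ≤ 4 ^ α := Real.one_le_rpow (by norm_num) hα.le
  have hMK : M ≤ 2 * 4 ^ α * M := by nlinarith
  have key : ∀ (S : ℝ) (x y : Euc n), 1 ≤ S → S ≤ 1 + ‖x‖ → S ≤ 1 + ‖y‖ →
      S ^ (ν + m + α) * ‖iteratedFDeriv ℝ m f x - iteratedFDeriv ℝ m f y‖
        ≤ 2 * 4 ^ α * M * ‖x - y‖ ^ α := by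
    intro S x y hS hx hy
    have hS0 : 0 < S := by linarith
    rcases le_or_gt ‖x - y‖ ((1 + ‖x‖) / 4) with h | h
    · calc _ ≤ S ^ (ν + m + α) * (M * (1 + ‖x‖) ^ (-(ν + m + α)) * ‖x - y‖ ^ α) := by
            gcongr; exact h3 x y h
        _ ≤ S ^ (ν + m + α) * (M * S ^ (-(ν + m + α)) * ‖x - y‖ ^ α) := by
            have := Real.rpow_le_rpow_of_nonpos hS0 hx
              (neg_nonpos.2 (by positivity : 0 ≤ ν + m + α))
            exact mul_le_mul_of_nonneg_left (mul_le_mul_of_nonneg_right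
              (mul_le_mul_of_nonneg_left this hM) (by positivity)) (by positivity)
        _ = M * ‖x - y‖ ^ α := by
            rw [Real.rpow_neg hS0.le]; field_simp
        _ ≤ _ := by gcongr
    · have hd : ∀ z : Euc n, S ≤ 1 + ‖z‖ →
          ‖iteratedFDeriv ℝ m f z‖ ≤ M * S ^ (-(ν + m)) := by
        intro z hz
        refine (h2 m le_rfl z).trans ?_
        exact mul_le_mul_of_nonneg_left (Real.rpow_le_rpow_of_nonpos hS0 hz
          (neg_nonpos.2 (by positivity))) hM
      calc _ ≤ S ^ (ν + m + α) * (M * S ^ (-(ν + m)) + M * S ^ (-(ν + m))) := by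
            gcongr
            exact (norm_sub_le _ _).trans (add_le_add (hd x hx) (hd y hy))
        _ = 2 * M * S ^ α := by
            rw [Real.rpow_add hS0, Real.rpow_neg hS0.le]; field_simp; ring
        _ ≤ 2 * M * (4 * ‖x - y‖) ^ α := by
            gcongr; linarith
        _ = _ := by
            rw [Real.mul_rpow (by norm_num) (norm_nonneg _)]; ring
  refine ⟨h1, fun i hi x => ?_, fun R hR x y hx _ hy _ _ => ?_, fun x y _ _ _ => ?_⟩
  · have hw : 0 < 1 + ‖x‖ := by positivity
    calc _ ≤ (1 + ‖x‖) ^ (ν + i) * (M * (1 + ‖x‖) ^ (-(ν + i))) := by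
          gcongr; exact h2 i hi x
      _ = M := by rw [Real.rpow_neg hw.le]; field_simp
      _ ≤ _ := hMK
  · exact key (1 + R) x y (by linarith) (by linarith) (by linarith)
  · simpa using key 1 x y le_rfl (by simp) (by simp)

end Equivalence

section ScaleEstimates

variable {n : ℕ} {E : Type*} [NormedAddCommGroup E] [NormedSpace ℝ E]

lemma hasCompactSupport_of_tsupport_subset_closedBall {A : Euc n → ℝ} {r : ℝ}
    (hr : tsupport A ⊆ Metric.closedBall 0 r) : HasCompactSupport A :=
  (isCompact_closedBall _ _).of_isClosed_subset (isClosed_tsupport _) hr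

/-- Decay of the derivatives of an average in the scale. -/
lemma exists_norm_iteratedFDeriv_kerAvg_le_rpow (hn : 1 ≤ n) {ν : ℝ} (hν0 : 0 ≤ ν) (hν : ν < n)
    {A : Euc n → ℝ} (hA : ContDiff ℝ ∞ A) {r : ℝ} (hr : tsupport A ⊆ Metric.closedBall 0 r)
    (i : ℕ) :
    ∃ K : ℝ, 0 ≤ K ∧ ∀ (g : Euc n → E) (M : ℝ), Continuous g → 0 ≤ M →
      (∀ y, ‖g y‖ ≤ M * (1 + ‖y‖) ^ (-ν)) → ∀ s : ℝ, 0 < s → ∀ x : Euc n,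
      ‖iteratedFDeriv ℝ i (kerAvg n A s g) x‖ ≤ K * M * s ^ (-(ν + i)) := by
  obtain ⟨C, hC, h1⟩ := exists_norm_iteratedFDeriv_kerAvg_le (E := E) r i A hA hr
  obtain ⟨D, hD, h2⟩ := exists_integral_norm_comp_le (E := E) hn r hν0 hν
  refine ⟨C * D, by positivity, fun g M hg hM hgM s hs x => ?_⟩
  calc _ ≤ C * (s⁻¹) ^ i * (D * M * s ^ (-ν)) := by
        refine (h1 g hg s hs x).trans ?_
        gcongr
        exact h2 g M hg hM hgM s hs x
    _ = C * D * M * (s ^ (-ν) * (s⁻¹) ^ i) := by ring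
    _ = _ := by
        congr 1
        rw [neg_add, Real.rpow_add hs, Real.rpow_neg hs.le (i:ℝ), Real.rpow_natCast, inv_pow]

lemma exists_norm_iteratedFDeriv_kerAvg_le_of_ball {A : Euc n → ℝ} (hA : ContDiff ℝ ∞ A) {r : ℝ}
    (hr : tsupport A ⊆ Metric.closedBall 0 r) (q : ℕ) :
    ∃ K : ℝ, 0 ≤ K ∧ ∀ (g : Euc n → E) (B : ℝ), Continuous g → ∀ s : ℝ, 0 < s → ∀ x : Euc n,
      (∀ z, ‖z‖ ≤ r → ‖g (x - s • z)‖ ≤ B) →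
      ‖iteratedFDeriv ℝ q (kerAvg n A s g) x‖ ≤ K * (s⁻¹) ^ q * B := by
  obtain ⟨C, hC, h1⟩ := exists_norm_iteratedFDeriv_kerAvg_le (E := E) r q A hA hr
  refine ⟨C * volume.real (Metric.closedBall (0 : Euc n) r), by positivity,
    fun g B hg s hs x hB => (h1 g hg s hs x).trans ?_⟩
  have h3 : ∫ z in Metric.closedBall (0 : Euc n) r, ‖g (x - s • z)‖
      ≤ ∫ _z in Metric.closedBall (0 : Euc n) r, B := by
    refine setIntegral_mono_on ?_ ?_ measurableSet_closedBall fun z hz => hB z (by simpa using hz)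
    · exact ContinuousOn.integrableOn_compact (isCompact_closedBall _ _) (by fun_prop)
    · exact continuousOn_const.integrableOn_compact (isCompact_closedBall _ _)
  rw [setIntegral_const, smul_eq_mul] at h3
  calc _ ≤ C * (s⁻¹) ^ q * (volume.real (Metric.closedBall (0 : Euc n) r) * B) := by gcongr
    _ = _ := by ring

lemma rpow_neg_le_of_div_le {r s w p : ℝ} (hr : 0 < r) (hw : 0 < w) (hp : 0 ≤ p)
    (h : w / 4 ≤ r * s) : s ^ (-p) ≤ (4 * r) ^ p * w ^ (-p) := by
  have h1 : w / (4 * r) ≤ s := by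
    rw [div_le_iff₀ (by positivity)]; linarith
  refine (Real.rpow_le_rpow_of_nonpos (by positivity) h1 (neg_nonpos.2 hp)).trans_eq ?_
  rw [Real.div_rpow hw.le (by positivity), Real.rpow_neg (by positivity : 0 ≤ 4 * r),
    div_inv_eq_mul, mul_comm]

lemma norm_smul_le_quarter {r s : ℝ} (hs : 0 < s) {x z : Euc n} (hz : ‖z‖ ≤ r)
    (h : r * s ≤ (1 + ‖x‖) / 4) : ‖s • z‖ ≤ s * r ∧ ‖s • z‖ ≤ (1 + ‖x‖) / 4 := by
  have : ‖s • z‖ ≤ s * r := by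
    rw [norm_smul, Real.norm_eq_abs, abs_of_pos hs]; gcongr
  exact ⟨this, by linarith⟩

lemma half_le_one_add_norm_of_close {x y : Euc n} (h : ‖x - y‖ ≤ (1 + ‖x‖) / 4) :
    (1 + ‖x‖) / 2 ≤ 1 + ‖y‖ := by
  have := norm_sub_norm_le x y
  linarith [norm_nonneg x]

lemma exists_norm_iteratedFDeriv_kerAvg_le_low (hn : 1 ≤ n) {ν α : ℝ} (hν0 : 0 ≤ ν) (hν : ν < n)
    {A : Euc n → ℝ} (hA : ContDiff ℝ ∞ A) {r : ℝ} (hr0 : 0 < r)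
    (hr : tsupport A ⊆ Metric.closedBall 0 r) {m i : ℕ} (hi : i ≤ m) :
    ∃ K : ℝ, 0 ≤ K ∧ ∀ (f : Euc n → E) (M : ℝ), HolderDecay n m α ν M f →
      ∀ s : ℝ, 0 < s → ∀ x : Euc n,
      ‖iteratedFDeriv ℝ i (kerAvg n A s f) x‖ ≤ K * M * (1 + ‖x‖) ^ (-(ν + i)) := by
  obtain ⟨K₁, hK₁, h1⟩ := exists_norm_iteratedFDeriv_kerAvg_le_rpow (E := E) hn hν0 hν hA hr i
  obtain ⟨K₂, hK₂, h2⟩ := exists_norm_iteratedFDeriv_kerAvg_le_of_ball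
    (E := (Euc n) [×i]→L[ℝ] E) hA hr 0
  have hc := hasCompactSupport_of_tsupport_subset_closedBall hr
  refine ⟨K₁ * (4 * r) ^ (ν + i) + K₂ * 2 ^ (ν + i), by positivity, fun f M hf s hs x => ?_⟩
  have hM := hf.nonneg
  have hw : 0 < 1 + ‖x‖ := by positivity
  rcases le_total (r * s) ((1 + ‖x‖) / 4) with h | h
  · have hfi : ContDiff ℝ i f := hf.1.of_le (by exact_mod_cast hi)
    have hcont : Continuous (iteratedFDeriv ℝ i f) :=
      hfi.continuous_iteratedFDeriv le_rfl
    have h3 := h2 (iteratedFDeriv ℝ i f) (M * (2 ^ (ν + i) * (1 + ‖x‖) ^ (-(ν + i)))) hcont s hs x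
      (fun z hz => by
        have hz2 := (norm_smul_le_quarter hs hz h).2
        have h4 : (1 + ‖x‖) / 2 ≤ 1 + ‖x - s • z‖ :=
          half_le_one_add_norm_of_close (by simpa using hz2)
        refine (hf.2.1 i hi _).trans (mul_le_mul_of_nonneg_left ?_ hM)
        refine (Real.rpow_le_rpow_of_nonpos (by positivity) h4
          (neg_nonpos.2 (by positivity))).trans_eq ?_
        rw [Real.div_rpow hw.le (by positivity), Real.rpow_neg (by positivity : (0:ℝ) ≤ 2),
          div_inv_eq_mul, mul_comm])
    rw [norm_iteratedFDeriv_zero, pow_zero, mul_one, ← iteratedFDeriv_kerAvg hA.continuous hc s i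
      hfi] at h3
    calc _ ≤ _ := h3
      _ = (0 + K₂ * 2 ^ (ν + i)) * M * (1 + ‖x‖) ^ (-(ν + i)) := by ring
      _ ≤ _ := by gcongr; positivity
  · have h0 : ∀ y, ‖f y‖ ≤ M * (1 + ‖y‖) ^ (-ν) := fun y => by
      simpa using hf.2.1 0 (Nat.zero_le _) y
    calc _ ≤ K₁ * M * s ^ (-(ν + i)) := h1 f M hf.1.continuous hM h0 s hs x
      _ ≤ K₁ * M * ((4 * r) ^ (ν + i) * (1 + ‖x‖) ^ (-(ν + i))) := by
        gcongr; exact rpow_neg_le_of_div_le hr0 hw (by positivity) h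
      _ = (K₁ * (4 * r) ^ (ν + i) + 0) * M * (1 + ‖x‖) ^ (-(ν + i)) := by ring
      _ ≤ _ := by gcongr; positivity

lemma kerAvg_sub_const {A : Euc n → ℝ} (hA : Continuous A) (hc : HasCompactSupport A)
    {g : Euc n → E} (hg : Continuous g) (s : ℝ) (c : E) :
    kerAvg n A s (fun y => g y - c) = fun x => kerAvg n A s g x - (∫ z, A z • c) := by
  funext x
  simp only [kerAvg, smul_sub]
  exact integral_sub (integrable_kerAvg hA hc hg s x)
    (integrable_kerAvg hA hc (continuous_const (y := c)) s x)

lemma exists_norm_iteratedFDeriv_kerAvg_le_high (hn : 1 ≤ n) {ν α : ℝ} (hν0 : 0 ≤ ν) (hν : ν < n)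
    (hα : 0 < α)
    {A : Euc n → ℝ} (hA : ContDiff ℝ ∞ A) {r : ℝ} (hr0 : 0 < r)
    (hr : tsupport A ⊆ Metric.closedBall 0 r) (m : ℕ) {q : ℕ} (hq : q ≠ 0) :
    ∃ K : ℝ, 0 ≤ K ∧ ∀ (f : Euc n → E) (M : ℝ), HolderDecay n m α ν M f →
      ∀ s : ℝ, 0 < s → ∀ x : Euc n,
      ‖iteratedFDeriv ℝ (m + q) (kerAvg n A s f) x‖
        ≤ K * M * s ^ (α - q) * (1 + ‖x‖) ^ (-(ν + m + α)) := by
  obtain ⟨K₁, hK₁, h1⟩ :=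
    exists_norm_iteratedFDeriv_kerAvg_le_rpow (E := E) hn hν0 hν hA hr (m + q)
  obtain ⟨K₂, hK₂, h2⟩ := exists_norm_iteratedFDeriv_kerAvg_le_of_ball
    (E := (Euc n) [×m]→L[ℝ] E) hA hr q
  have hc := hasCompactSupport_of_tsupport_subset_closedBall hr
  refine ⟨K₁ * (4 * r) ^ (ν + m + α) + K₂ * r ^ α, by positivity, fun f M hf s hs x => ?_⟩
  have hM := hf.nonneg
  have hw : 0 < 1 + ‖x‖ := by positivity
  rcases le_total (r * s) ((1 + ‖x‖) / 4) with h | h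
  · set h' := iteratedFDeriv ℝ m f with hh'
    have hcont : Continuous h' := hf.1.continuous_iteratedFDeriv le_rfl
    have h3 := h2 (fun y => h' y - h' x) (M * (1 + ‖x‖) ^ (-(ν + m + α)) * (s * r) ^ α)
      (by fun_prop) s hs x (fun z hz => by
        obtain ⟨hz1, hz2⟩ := norm_smul_le_quarter hs hz h
        rw [norm_sub_rev]
        refine (hf.2.2 x (x - s • z) (by simpa using hz2)).trans ?_
        rw [sub_sub_cancel]
        gcongr)
    rw [kerAvg_sub_const hA.continuous hc hcont] at h3
    have h5 : iteratedFDeriv ℝ q (fun y => kerAvg n A s h' y - ∫ z, A z • h' x) x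
        = iteratedFDeriv ℝ q (kerAvg n A s h') x := by
      have hsm : ContDiffAt ℝ q (kerAvg n A s h') x :=
        ((contDiff_kerAvg hA hc hcont hs).of_le (by exact_mod_cast le_top)).contDiffAt
      have := iteratedFDeriv_sub_apply hsm
        (contDiff_const (c := ∫ z, A z • h' x)).contDiffAt
      rw [iteratedFDeriv_const_of_ne hq] at this
      simpa [Pi.sub_def] using this
    rw [h5, hh', ← iteratedFDeriv_kerAvg hA.continuous hc s m hf.1,
      norm_iteratedFDeriv_iteratedFDeriv_add] at h3
    calc _ ≤ _ := h3
      _ = (0 + K₂ * r ^ α) * M * s ^ (α - q) * (1 + ‖x‖) ^ (-(ν + m + α)) := by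
        rw [Real.mul_rpow hs.le hr0.le, Real.rpow_sub hs, Real.rpow_natCast, inv_pow]
        field_simp
        ring
      _ ≤ _ := by gcongr; positivity
  · have h0 : ∀ y, ‖f y‖ ≤ M * (1 + ‖y‖) ^ (-ν) := fun y => by
      simpa using hf.2.1 0 (Nat.zero_le _) y
    calc _ ≤ K₁ * M * s ^ (-(ν + (m + q : ℕ))) := h1 f M hf.1.continuous hM h0 s hs x
      _ = K₁ * M * (s ^ (α - q) * s ^ (-(ν + m + α))) := by
        rw [← Real.rpow_add hs]; push_cast; ring_nf
      _ ≤ K₁ * M * (s ^ (α - q) * ((4 * r) ^ (ν + m + α) * (1 + ‖x‖) ^ (-(ν + m + α)))) := by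
        gcongr; exact rpow_neg_le_of_div_le hr0 hw (by positivity) h
      _ = (K₁ * (4 * r) ^ (ν + m + α) + 0) * M * s ^ (α - q) * (1 + ‖x‖) ^ (-(ν + m + α)) := by
        ring
      _ ≤ _ := by gcongr; positivity

end ScaleEstimates

/-- The contribution of the scale `2 ^ j` to the potential with profile `A`. -/
def dyadTerm (n : ℕ) {E : Type*} [NormedAddCommGroup E] [NormedSpace ℝ E]
    (A : Euc n → ℝ) (f : Euc n → E) (j : ℤ) (x : Euc n) : E :=
  ((2:ℝ) ^ j) ^ 2 • kerAvg n A ((2:ℝ) ^ j) f x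

/-- The potential of `f` with profile `A`, as a sum over dyadic scales. -/
def dyadSum (n : ℕ) {E : Type*} [NormedAddCommGroup E] [NormedSpace ℝ E]
    (A : Euc n → ℝ) (f : Euc n → E) (x : Euc n) : E :=
  ∑' j : ℤ, dyadTerm n A f j x

section DyadicSums

variable {n : ℕ} {E : Type*} [NormedAddCommGroup E] [NormedSpace ℝ E]

lemma contDiff_dyadTerm {A : Euc n → ℝ} (hA : ContDiff ℝ ∞ A) (hc : HasCompactSupport A)
    {f : Euc n → E} (hf : Continuous f) (j : ℤ) : ContDiff ℝ ∞ (dyadTerm n A f j) :=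
  (contDiff_kerAvg hA hc hf (by positivity)).const_smul _

lemma norm_iteratedFDeriv_dyadTerm {A : Euc n → ℝ} (hA : ContDiff ℝ ∞ A)
    (hc : HasCompactSupport A) {f : Euc n → E} (hf : Continuous f) (i : ℕ) (j : ℤ) (x : Euc n) :
    ‖iteratedFDeriv ℝ i (dyadTerm n A f j) x‖
      = ((2:ℝ) ^ j) ^ 2 * ‖iteratedFDeriv ℝ i (kerAvg n A ((2:ℝ) ^ j) f) x‖ := by
  have h : ContDiffAt ℝ i (kerAvg n A ((2:ℝ) ^ j) f) x :=
    ((contDiff_kerAvg hA hc hf (by positivity)).of_le (by exact_mod_cast le_top)).contDiffAt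
  unfold dyadTerm
  rw [iteratedFDeriv_const_smul_apply' h, norm_smul, Real.norm_eq_abs, abs_of_pos (by positivity)]

lemma exists_norm_iteratedFDeriv_dyadTerm_le (hn : 1 ≤ n) {ν α : ℝ} (hν0 : 2 < ν) (hν : ν < n)
    (hα : 0 < α) {A : Euc n → ℝ} (hA : ContDiff ℝ ∞ A) {r : ℝ} (hr0 : 0 < r)
    (hr : tsupport A ⊆ Metric.closedBall 0 r) {m i : ℕ} (hi : i ≤ m + 2) :
    ∃ a : ℝ, 0 < a ∧ ∃ K : ℝ, 0 ≤ K ∧ ∀ (f : Euc n → E) (M : ℝ), HolderDecay n m α ν M f →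
      ∀ (j : ℤ) (x : Euc n),
      ‖iteratedFDeriv ℝ i (dyadTerm n A f j) x‖
        ≤ K * M * (1 + ‖x‖) ^ (-(ν - 2 + i)) * ((2:ℝ) ^ j / (1 + ‖x‖)) ^ a ∧
      ‖iteratedFDeriv ℝ i (dyadTerm n A f j) x‖
        ≤ K * M * (1 + ‖x‖) ^ (-(ν - 2 + i)) * ((2:ℝ) ^ j / (1 + ‖x‖)) ^ (-(ν - 2 + i)) := by
  have hc := hasCompactSupport_of_tsupport_subset_closedBall hr
  have hsmall : ∃ a : ℝ, 0 < a ∧ ∃ K : ℝ, 0 ≤ K ∧ ∀ (f : Euc n → E) (M : ℝ),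
      HolderDecay n m α ν M f → ∀ (s : ℝ), 0 < s → ∀ x : Euc n,
      ‖iteratedFDeriv ℝ i (kerAvg n A s f) x‖
        ≤ K * M * s ^ (a - 2) * (1 + ‖x‖) ^ (-(ν - 2 + i + a)) := by
    rcases le_or_gt i m with him | him
    · obtain ⟨K, hK, h⟩ := exists_norm_iteratedFDeriv_kerAvg_le_low (E := E) (α := α) hn
        (by linarith) hν hA hr0 hr him
      refine ⟨2, two_pos, K, hK, fun f M hf s hs x => (h f M hf s hs x).trans_eq ?_⟩
      simp only [sub_self, Real.rpow_zero, mul_one]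
      ring_nf
    · obtain ⟨q, rfl⟩ := Nat.exists_eq_add_of_le him.le
      have hq2 : (q : ℝ) ≤ 2 := by exact_mod_cast (by omega : q ≤ 2)
      obtain ⟨K, hK, h⟩ := exists_norm_iteratedFDeriv_kerAvg_le_high (E := E) (α := α) hn
        (by linarith) hν hα hA hr0 hr m (q := q) (by omega)
      refine ⟨2 + α - q, by linarith, K, hK, fun f M hf s hs x => (h f M hf s hs x).trans_eq ?_⟩
      push_cast
      ring_nf
  obtain ⟨a, ha, K₁, hK₁, h1⟩ := hsmall
  obtain ⟨K₂, hK₂, h2⟩ :=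
    exists_norm_iteratedFDeriv_kerAvg_le_rpow (E := E) hn (by linarith) hν hA hr i
  refine ⟨a, ha, K₁ + K₂, by positivity, fun f M hf j x => ?_⟩
  have hM := hf.nonneg
  have hw : 0 < 1 + ‖x‖ := by positivity
  have h0 : ∀ y, ‖f y‖ ≤ M * (1 + ‖y‖) ^ (-ν) := fun y => by
    simpa using hf.2.1 0 (Nat.zero_le _) y
  rw [norm_iteratedFDeriv_dyadTerm hA hc hf.1.continuous]
  set s : ℝ := (2:ℝ) ^ j
  have hs : 0 < s := by positivity
  have hs2 : s ^ 2 = s ^ (2:ℝ) := (Real.rpow_two s).symm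
  constructor
  · calc _ ≤ s ^ 2 * (K₁ * M * s ^ (a - 2) * (1 + ‖x‖) ^ (-(ν - 2 + i + a))) := by
          gcongr; exact h1 f M hf s hs x
      _ = (K₁ + 0) * M * (1 + ‖x‖) ^ (-(ν - 2 + i)) * (s / (1 + ‖x‖)) ^ a := by
          rw [Real.div_rpow hs.le hw.le, neg_add (ν - 2 + i), Real.rpow_add hw,
            Real.rpow_neg hw.le a, Real.rpow_sub hs, hs2]
          field_simp
          ring
      _ ≤ _ := by gcongr
  · calc _ ≤ s ^ 2 * (K₂ * M * s ^ (-(ν + i))) := by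
          gcongr; exact h2 f M hf.1.continuous hM h0 s hs x
      _ = (0 + K₂) * M * s ^ (-(ν - 2 + i)) := by
          rw [show -(ν - 2 + (i:ℝ)) = -(ν + i) + 2 by ring, Real.rpow_add hs, hs2]
          ring
      _ = (0 + K₂) * M * (1 + ‖x‖) ^ (-(ν - 2 + i)) * (s / (1 + ‖x‖)) ^ (-(ν - 2 + i)) := by
          rw [Real.div_rpow hs.le hw.le]
          field_simp
      _ ≤ _ := by gcongr

/-- Pointwise decay of the derivatives of the dyadic sum. -/
lemma exists_tsum_norm_iteratedFDeriv_dyadTerm_le (hn : 1 ≤ n) {ν α : ℝ} (hν0 : 2 < ν) (hν : ν < n)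
    (hα : 0 < α) {A : Euc n → ℝ} (hA : ContDiff ℝ ∞ A) {r : ℝ} (hr0 : 0 < r)
    (hr : tsupport A ⊆ Metric.closedBall 0 r) {m i : ℕ} (hi : i ≤ m + 2) :
    ∃ K : ℝ, 0 ≤ K ∧ ∀ (f : Euc n → E) (M : ℝ), HolderDecay n m α ν M f → ∀ x : Euc n,
      Summable (fun j : ℤ => ‖iteratedFDeriv ℝ i (dyadTerm n A f j) x‖) ∧
      ∑' j : ℤ, ‖iteratedFDeriv ℝ i (dyadTerm n A f j) x‖
        ≤ K * M * (1 + ‖x‖) ^ (-(ν - 2 + i)) := by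
  obtain ⟨a, ha, K, hK, h⟩ :=
    exists_norm_iteratedFDeriv_dyadTerm_le (E := E) hn hν0 hν hα hA hr0 hr hi
  obtain ⟨C, hC, hC'⟩ := exists_dyadic_sum_le ha
    (show 0 < ν - 2 + i by have := Nat.cast_nonneg (α := ℝ) i; linarith)
  refine ⟨C * K, by positivity, fun f M hf x => ?_⟩
  have hM := hf.nonneg
  have := hC' (1 + ‖x‖) (K * M * (1 + ‖x‖) ^ (-(ν - 2 + i))) _ (by positivity) (by positivity)
    (fun j => norm_nonneg _) (fun j => (h f M hf j x).1) (fun j => (h f M hf j x).2)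
  exact ⟨this.1, this.2.trans_eq (by ring)⟩

/-- Summable bounds for the derivatives of the dyadic pieces, uniform in the point. -/
lemma exists_summable_bound_dyadTerm (hn : 1 ≤ n) {ν α : ℝ} (hν0 : 2 < ν) (hν : ν < n)
    (hα : 0 < α) {A : Euc n → ℝ} (hA : ContDiff ℝ ∞ A) {r : ℝ} (hr0 : 0 < r)
    (hr : tsupport A ⊆ Metric.closedBall 0 r) {m : ℕ} {f : Euc n → E} {M : ℝ}
    (hf : HolderDecay n m α ν M f) :
    ∃ v : ℕ → ℤ → ℝ, ∀ i ≤ m + 2, Summable (v i) ∧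
      ∀ j x, ‖iteratedFDeriv ℝ i (dyadTerm n A f j) x‖ ≤ v i j := by
  have key : ∀ i : ℕ, ∃ v : ℤ → ℝ, i ≤ m + 2 → Summable v ∧
      ∀ j x, ‖iteratedFDeriv ℝ i (dyadTerm n A f j) x‖ ≤ v j := by
    intro i
    by_cases hi : i ≤ m + 2
    swap
    · exact ⟨0, fun h => absurd h hi⟩
    have hM := hf.nonneg
    have hb : 0 < ν - 2 + i := by have := Nat.cast_nonneg (α := ℝ) i; linarith
    obtain ⟨a, ha, K, hK, h⟩ :=
      exists_norm_iteratedFDeriv_dyadTerm_le (E := E) hn hν0 hν hα hA hr0 hr hi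
    obtain ⟨C, hC, hC'⟩ := exists_dyadic_sum_le ha hb
    refine ⟨fun j => min (K * M * ((2:ℝ) ^ j / 1) ^ a) (K * M * ((2:ℝ) ^ j / 1) ^ (-(ν - 2 + i))),
      fun _ => ⟨(hC' 1 (K * M) _ one_pos (by positivity) (fun j => by positivity)
        (fun j => min_le_left _ _) (fun j => min_le_right _ _)).1, fun j x => ?_⟩⟩
    have hw : 1 ≤ 1 + ‖x‖ := by simp
    have hs : 0 < (2:ℝ) ^ j := by positivity
    refine le_min ((h f M hf j x).1.trans ?_) ((h f M hf j x).2.trans_eq ?_)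
    · rw [mul_assoc]
      gcongr
      refine (mul_le_of_le_one_left (by positivity)
        (Real.rpow_le_one_of_one_le_of_nonpos hw (by linarith))).trans ?_
      gcongr
    · rw [div_one, Real.div_rpow hs.le (by linarith)]
      field_simp
  choose v hv using key
  exact ⟨v, fun i hi => hv i hi⟩

/-- Hölder continuity of the top derivatives of the dyadic sum. -/
lemma exists_tsum_norm_iteratedFDeriv_dyadTerm_sub_le (hn : 1 ≤ n) {ν α : ℝ} (hν0 : 2 < ν)
    (hν : ν < n)
    (hα : 0 < α) (hα1 : α < 1) {A : Euc n → ℝ} (hA : ContDiff ℝ ∞ A) {r : ℝ} (hr0 : 0 < r)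
    (hr : tsupport A ⊆ Metric.closedBall 0 r) (m : ℕ) :
    ∃ K : ℝ, 0 ≤ K ∧ ∀ (f : Euc n → E) (M : ℝ), HolderDecay n m α ν M f → ∀ x y : Euc n,
      x ≠ y → ‖x - y‖ ≤ (1 + ‖x‖) / 4 →
      Summable (fun j : ℤ => ‖iteratedFDeriv ℝ (m + 2) (dyadTerm n A f j) x
        - iteratedFDeriv ℝ (m + 2) (dyadTerm n A f j) y‖) ∧
      ∑' j : ℤ, ‖iteratedFDeriv ℝ (m + 2) (dyadTerm n A f j) x
        - iteratedFDeriv ℝ (m + 2) (dyadTerm n A f j) y‖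
        ≤ K * M * (1 + ‖x‖) ^ (-(ν + m + α)) * ‖x - y‖ ^ α := by
  have hc := hasCompactSupport_of_tsupport_subset_closedBall hr
  obtain ⟨K₂, hK₂, h2⟩ := exists_norm_iteratedFDeriv_kerAvg_le_high (E := E) (α := α) hn
    (by linarith) hν hα hA hr0 hr m (q := 2) (by simp)
  obtain ⟨K₃, hK₃, h3⟩ := exists_norm_iteratedFDeriv_kerAvg_le_high (E := E) (α := α) hn
    (by linarith) hν hα hA hr0 hr m (q := 3) (by simp)
  obtain ⟨C, hC, hC'⟩ := exists_dyadic_sum_le hα (show 0 < 1 - α by linarith)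
  set p : ℝ := ν + m + α with hp
  have hp0 : 0 ≤ p := by positivity
  refine ⟨C * ((2 * K₂ + K₃) * 2 ^ p), by positivity, fun f M hf x y hne hxy => ?_⟩
  have hM := hf.nonneg
  have hw : 0 < 1 + ‖x‖ := by positivity
  have hδ : 0 < ‖x - y‖ := norm_pos_iff.2 (sub_ne_zero.2 hne)
  set δ := ‖x - y‖ with hδdef
  have hcmp : ∀ z : Euc n, ‖x - z‖ ≤ δ → (1 + ‖z‖) ^ (-p) ≤ 2 ^ p * (1 + ‖x‖) ^ (-p) := by
    intro z hz
    refine (Real.rpow_le_rpow_of_nonpos (by positivity)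
      (half_le_one_add_norm_of_close (hz.trans hxy)) (neg_nonpos.2 hp0)).trans_eq ?_
    rw [Real.div_rpow hw.le (by positivity), Real.rpow_neg (by positivity : (0:ℝ) ≤ 2),
          div_inv_eq_mul, mul_comm]
  have hD : ∀ (q : ℕ) (K : ℝ), 0 ≤ K → (∀ s : ℝ, 0 < s → ∀ x : Euc n,
      ‖iteratedFDeriv ℝ (m + q) (kerAvg n A s f) x‖ ≤ K * M * s ^ (α - q) * (1 + ‖x‖) ^ (-p)) →
      ∀ (j : ℤ) (z : Euc n), ‖x - z‖ ≤ δ →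
      ‖iteratedFDeriv ℝ (m + q) (dyadTerm n A f j) z‖
        ≤ K * M * 2 ^ p * (1 + ‖x‖) ^ (-p) * ((2:ℝ) ^ j) ^ (α + 2 - q) := by
    intro q K hK hq j z hz
    rw [norm_iteratedFDeriv_dyadTerm hA hc hf.1.continuous]
    have hs : 0 < (2:ℝ) ^ j := by positivity
    calc _ ≤ ((2:ℝ) ^ j) ^ 2 * (K * M * ((2:ℝ) ^ j) ^ (α - q)
          * (2 ^ p * (1 + ‖x‖) ^ (-p))) := by
          gcongr
          refine (hq _ hs z).trans ?_
          exact mul_le_mul_of_nonneg_left (hcmp z hz) (by positivity)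
      _ = _ := by
          rw [show α + 2 - q = α - q + 2 by ring, Real.rpow_add hs, Real.rpow_two]
          ring
  have hD2 := hD 2 K₂ hK₂ (h2 f M hf)
  have hD3 := hD 3 K₃ hK₃ (h3 f M hf)
  have := hC' δ ((2 * K₂ + K₃) * 2 ^ p * M * (1 + ‖x‖) ^ (-p) * δ ^ α)
    (fun j : ℤ => ‖iteratedFDeriv ℝ (m + 2) (dyadTerm n A f j) x
        - iteratedFDeriv ℝ (m + 2) (dyadTerm n A f j) y‖) hδ (by positivity)
    (fun j => norm_nonneg _) (fun j => ?_) (fun j => ?_)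
  · exact ⟨this.1, this.2.trans_eq (by ring)⟩
  · have hs : 0 < (2:ℝ) ^ j := by positivity
    calc _ ≤ K₂ * M * 2 ^ p * (1 + ‖x‖) ^ (-p) * ((2:ℝ) ^ j) ^ (α + 2 - (2:ℕ))
          + K₂ * M * 2 ^ p * (1 + ‖x‖) ^ (-p) * ((2:ℝ) ^ j) ^ (α + 2 - (2:ℕ)) :=
          (norm_sub_le _ _).trans
            (add_le_add (hD2 j x (by simpa using hδ.le)) (hD2 j y le_rfl))
      _ = (2 * K₂ + 0) * 2 ^ p * M * (1 + ‖x‖) ^ (-p) * ((2:ℝ) ^ j) ^ α := by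
          push_cast
          rw [add_sub_cancel_right]
          ring
      _ = (2 * K₂ + 0) * 2 ^ p * M * (1 + ‖x‖) ^ (-p) * δ ^ α * ((2:ℝ) ^ j / δ) ^ α := by
          rw [Real.div_rpow hs.le hδ.le]
          field_simp
      _ ≤ _ := by gcongr
  · have hs : 0 < (2:ℝ) ^ j := by positivity
    set u := dyadTerm n A f j with hu
    have husm : ContDiff ℝ ∞ u := contDiff_dyadTerm hA hc hf.1.continuous j
    have hmv := (convex_segment x y).norm_image_sub_le_of_norm_fderiv_le (𝕜 := ℝ)
      (f := iteratedFDeriv ℝ (m + 2) u)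
      (C := K₃ * M * 2 ^ p * (1 + ‖x‖) ^ (-p) * ((2:ℝ) ^ j) ^ (α + 2 - (3:ℕ)))
      (fun z _ => (husm.differentiable_iteratedFDeriv
        (WithTop.coe_lt_coe.2 (ENat.natCast_lt_top (m + 2)))) z)
      (fun z hz => by
        rw [norm_fderiv_iteratedFDeriv]
        refine hD3 j z ?_
        have := dist_add_dist_of_mem_segment hz
        simp only [dist_eq_norm] at this
        linarith [norm_nonneg (z - y)]) (right_mem_segment ℝ x y) (left_mem_segment ℝ x y)
    calc _ ≤ _ := hmv
      _ = (0 + K₃) * 2 ^ p * M * (1 + ‖x‖) ^ (-p) * δ ^ α * ((2:ℝ) ^ j / δ) ^ (-(1 - α)) := by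
          rw [Real.div_rpow hs.le hδ.le, show -(1 - α) = α - 1 by ring,
            Real.rpow_sub hδ, Real.rpow_one]
          push_cast
          rw [show α + 2 - 3 = α - 1 by ring]
          field_simp
          ring
      _ ≤ _ := by gcongr; linarith

variable [CompleteSpace E]

lemma contDiff_dyadSum (hn : 1 ≤ n) {ν α : ℝ} (hν0 : 2 < ν) (hν : ν < n)
    (hα : 0 < α) {A : Euc n → ℝ} (hA : ContDiff ℝ ∞ A) {r : ℝ} (hr0 : 0 < r)
    (hr : tsupport A ⊆ Metric.closedBall 0 r) {m : ℕ} {f : Euc n → E} {M : ℝ}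
    (hf : HolderDecay n m α ν M f) :
    ContDiff ℝ (m + 2 : ℕ) (dyadSum n A f) ∧ ∀ i ≤ m + 2, ∀ x,
      iteratedFDeriv ℝ i (dyadSum n A f) x = ∑' j, iteratedFDeriv ℝ i (dyadTerm n A f j) x := by
  have hc := hasCompactSupport_of_tsupport_subset_closedBall hr
  obtain ⟨v, hv⟩ := exists_summable_bound_dyadTerm hn hν0 hν hα hA hr0 hr hf
  have h1 : ∀ j, ContDiff ℝ ((m + 2 : ℕ) : ℕ∞) (dyadTerm n A f j) := fun j =>
    (contDiff_dyadTerm hA hc hf.1.continuous j).of_le (by exact_mod_cast le_top)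
  have h2 : ∀ k : ℕ, (k : ℕ∞) ≤ (m + 2 : ℕ) → Summable (v k) := fun k hk =>
    (hv k (by exact_mod_cast hk)).1
  have h3 : ∀ (k : ℕ) (j : ℤ) (x : Euc n), (k : ℕ∞) ≤ (m + 2 : ℕ) →
      ‖iteratedFDeriv ℝ k (dyadTerm n A f j) x‖ ≤ v k j := fun k j x hk =>
    (hv k (by exact_mod_cast hk)).2 j x
  exact ⟨contDiff_tsum h1 h2 h3, fun i hi x =>
    iteratedFDeriv_tsum_apply h1 h2 h3 (by exact_mod_cast hi) x⟩

/-- The dyadic sum gains two derivatives and two orders of growth. -/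
theorem exists_holderDecay_dyadSum (hn : 1 ≤ n) {ν α : ℝ} (hν0 : 2 < ν) (hν : ν < n)
    (hα : 0 < α) (hα1 : α < 1) {A : Euc n → ℝ} (hA : ContDiff ℝ ∞ A) {r : ℝ} (hr0 : 0 < r)
    (hr : tsupport A ⊆ Metric.closedBall 0 r) (m : ℕ) :
    ∃ K : ℝ, 0 ≤ K ∧ ∀ (f : Euc n → E) (M : ℝ), HolderDecay n m α ν M f →
      HolderDecay n (m + 2) α (ν - 2) (K * M) (dyadSum n A f) := by
  have h1 : ∀ i : ℕ, ∃ K : ℝ, 0 ≤ K ∧ (i ≤ m + 2 → ∀ (f : Euc n → E) (M : ℝ),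
      HolderDecay n m α ν M f → ∀ x : Euc n,
      Summable (fun j : ℤ => ‖iteratedFDeriv ℝ i (dyadTerm n A f j) x‖) ∧
      ∑' j : ℤ, ‖iteratedFDeriv ℝ i (dyadTerm n A f j) x‖
        ≤ K * M * (1 + ‖x‖) ^ (-(ν - 2 + i))) := by
    intro i
    by_cases hi : i ≤ m + 2
    · obtain ⟨K, hK, h⟩ := exists_tsum_norm_iteratedFDeriv_dyadTerm_le (E := E) hn hν0 hν hα hA hr0
        hr hi
      exact ⟨K, hK, fun _ => h⟩
    · exact ⟨0, le_rfl, fun h => absurd h hi⟩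
  choose K₁ hK₁ h1 using h1
  obtain ⟨K₂, hK₂, h2⟩ :=
    exists_tsum_norm_iteratedFDeriv_dyadTerm_sub_le (E := E) hn hν0 hν hα hα1 hA hr0 hr m
  set S := ∑ i ∈ Finset.range (m + 3), K₁ i with hS
  have hS0 : 0 ≤ S := Finset.sum_nonneg fun i _ => hK₁ i
  refine ⟨S + K₂, by positivity, fun f M hf => ?_⟩
  have hM := hf.nonneg
  obtain ⟨hsm, hD⟩ := contDiff_dyadSum hn hν0 hν hα hA hr0 hr hf
  refine ⟨hsm, fun i hi x => ?_, fun x y hxy => ?_⟩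
  · obtain ⟨hsum, hle⟩ := h1 i hi f M hf x
    have hi' : K₁ i ≤ S :=
      Finset.single_le_sum (fun i _ => hK₁ i) (Finset.mem_range.2 (by omega))
    rw [hD i hi]
    refine (norm_tsum_le_tsum_norm hsum).trans (hle.trans ?_)
    have : K₁ i ≤ S + K₂ := by linarith
    have hw : 0 ≤ (1 + ‖x‖) ^ (-(ν - 2 + i)) := by positivity
    exact mul_le_mul_of_nonneg_right (mul_le_mul_of_nonneg_right this hM) hw
  · rcases eq_or_ne x y with rfl | hne
    · rw [sub_self, norm_zero]; positivity
    rw [hD _ le_rfl, hD _ le_rfl]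
    have hsx := (h1 (m + 2) le_rfl f M hf x).1.of_norm
    have hsy := (h1 (m + 2) le_rfl f M hf y).1.of_norm
    obtain ⟨hsum, hle⟩ := h2 f M hf x y hne hxy
    rw [← hsx.tsum_sub hsy]
    refine (norm_tsum_le_tsum_norm hsum).trans (hle.trans ?_)
    have e : ν - 2 + ((m + 2 : ℕ) : ℝ) + α = ν + m + α := by push_cast; ring
    rw [e]
    gcongr
    linarith

end DyadicSums

section PartialDerivatives

variable {n : ℕ} {f g : Euc n → ℝ}

lemma pder_add (hf : Differentiable ℝ f) (hg : Differentiable ℝ g) (i : Fin n) :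
    pder n (fun z => f z + g z) i = fun z => pder n f i z + pder n g i z := by
  funext z
  simp only [pder]
  rw [fderiv_fun_add (hf z) (hg z)]
  rfl

lemma pder_sub (hf : Differentiable ℝ f) (hg : Differentiable ℝ g) (i : Fin n) :
    pder n (fun z => f z - g z) i = fun z => pder n f i z - pder n g i z := by
  funext z
  simp only [pder]
  rw [fderiv_fun_sub (hf z) (hg z)]
  rfl

lemma pder_const_mul (hf : Differentiable ℝ f) (c : ℝ) (i : Fin n) :
    pder n (fun z => c * f z) i = fun z => c * pder n f i z := by
  funext z
  simp only [pder]
  rw [fderiv_const_mul (hf z)]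
  rfl

lemma pder_sum {ι : Type*} (s : Finset ι) {u : ι → Euc n → ℝ} (hu : ∀ k, Differentiable ℝ (u k))
    (i : Fin n) :
    pder n (fun z => ∑ k ∈ s, u k z) i = fun z => ∑ k ∈ s, pder n (u k) i z := by
  funext z
  simp only [pder]
  rw [fderiv_fun_sum fun k _ => hu k z, _root_.sum_apply]

lemma pder_coord_mul (hf : Differentiable ℝ f) (k i : Fin n) :
    pder n (fun z => z k * f z) i
      = fun z => (if i = k then 1 else 0) * f z + z k * pder n f i z := by
  funext z
  have h1 : HasFDerivAt (fun z : Euc n => z k) (EuclideanSpace.proj k : Euc n →L[ℝ] ℝ) z :=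
    (EuclideanSpace.proj k : Euc n →L[ℝ] ℝ).hasFDerivAt
  simp only [pder]
  rw [show (fun z : Euc n => z k * f z) = (fun z : Euc n => z k) * f from rfl,
    (h1.mul (hf z).hasFDerivAt).fderiv]
  simp [eq_comm, add_comm]

lemma pder_pder_eq (hf : ContDiff ℝ 2 f) (a b : Fin n) (x : Euc n) :
    pder n (pder n f a) b x = iteratedFDeriv ℝ 2 f x
      ![EuclideanSpace.single b 1, EuclideanSpace.single a 1] := by
  have h : DifferentiableAt ℝ (fderiv ℝ f) x :=
    (hf.fderiv_right (m := 1) (by norm_num)).differentiable one_ne_zero x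
  rw [iteratedFDeriv_two_apply]
  simp only [pder, Matrix.cons_val_zero, Matrix.cons_val_one]
  rw [show pder n f a = fun y => (fderiv ℝ f y) ((fun _ => EuclideanSpace.single a 1) y) from rfl,
    fderiv_clm_apply h (differentiableAt_const _)]
  simp

lemma pder_comm (hf : ContDiff ℝ 2 f) (a b : Fin n) :
    pder n (pder n f a) b = pder n (pder n f b) a := by
  funext x
  have h := (hf.contDiffAt (x := x)).isSymmSndFDerivAt (by simp)
  rw [pder_pder_eq hf, pder_pder_eq hf, iteratedFDeriv_two_apply, iteratedFDeriv_two_apply]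
  exact h _ _

lemma differentiable_pder (hf : ContDiff ℝ 2 f) (a : Fin n) : Differentiable ℝ (pder n f a) :=
  ((hf.fderiv_right (m := 1) (by norm_num)).clm_apply contDiff_const).differentiable one_ne_zero

lemma contDiff_lap (hf : ContDiff ℝ ∞ f) : ContDiff ℝ ∞ (lap n f) :=
  ContDiff.sum fun i _ => contDiff_pder (contDiff_pder hf i) i

lemma contDiff_coord_mul (hf : ContDiff ℝ ∞ f) (k : Fin n) :
    ContDiff ℝ ∞ fun z : Euc n => z k * f z :=
  (EuclideanSpace.proj k : Euc n →L[ℝ] ℝ).contDiff.mul hf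

lemma lap_pder (hf : ContDiff ℝ ∞ f) (j : Fin n) : lap n (pder n f j) = pder n (lap n f) j := by
  have hd : ∀ {u : Euc n → ℝ}, ContDiff ℝ ∞ u → ContDiff ℝ 2 u := fun hu =>
    by exact_mod_cast contDiff_infty.1 hu 2
  unfold lap
  rw [pder_sum _ fun i => differentiable_pder (hd (contDiff_pder hf i)) i]
  funext z
  refine Finset.sum_congr rfl fun i _ => ?_
  change pder n (pder n (pder n f j) i) i z = pder n (pder n (pder n f i) i) j z
  rw [pder_comm (hd hf) j i, pder_comm (hd (contDiff_pder hf i)) j i]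

lemma lap_coord_mul (hf : ContDiff ℝ ∞ f) (k : Fin n) :
    lap n (fun z => z k * f z) = fun z => 2 * pder n f k z + z k * lap n f z := by
  have hd : ∀ {u : Euc n → ℝ}, ContDiff ℝ ∞ u → Differentiable ℝ u :=
    fun hu => hu.differentiable (by simp)
  funext z
  have h : ∀ i, pder n (pder n (fun z => z k * f z) i) i z
      = 2 * ((if i = k then 1 else 0) * pder n f i z) + z k * pder n (pder n f i) i z := by
    intro i
    have hfi := contDiff_pder hf i
    rw [pder_coord_mul (hd hf), pder_add ((hd hf).const_mul _) (hd (contDiff_coord_mul hfi k)),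
      pder_const_mul (hd hf), pder_coord_mul (hd hfi)]
    ring
  have h2 : lap n (fun z => z k * f z) z = ∑ i, pder n (pder n (fun z => z k * f z) i) i z := rfl
  rw [h2, Finset.sum_congr rfl fun i _ => h i, Finset.sum_add_distrib, ← Finset.mul_sum,
    ← Finset.mul_sum]
  simp only [ite_mul, one_mul, zero_mul, Finset.sum_ite_eq', Finset.mem_univ, if_true]
  rfl

end PartialDerivatives

section Radial

variable {n : ℕ}

lemma contDiff_radial {p : ℝ → ℝ} (hp : ContDiff ℝ ∞ p) :
    ContDiff ℝ ∞ fun z : Euc n => p (‖z‖ ^ 2) :=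
  hp.comp (contDiff_norm_sq ℝ)

lemma pder_radial {p : ℝ → ℝ} (hp : Differentiable ℝ p) (j : Fin n) :
    pder n (fun z => p (‖z‖ ^ 2)) j = fun z => z j * (2 * deriv p (‖z‖ ^ 2)) := by
  funext z
  have h1 : HasFDerivAt (fun z : Euc n => ‖z‖ ^ 2) (2 • innerSL ℝ z) z :=
    (hasStrictFDerivAt_norm_sq z).hasFDerivAt
  have h2 := (hp (‖z‖ ^ 2)).hasDerivAt.comp_hasFDerivAt z h1
  simp only [pder]
  rw [show (fun z : Euc n => p (‖z‖ ^ 2)) = p ∘ fun z => ‖z‖ ^ 2 from rfl, h2.fderiv]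
  simp [EuclideanSpace.inner_single_right]
  ring

lemma contDiff_deriv_of_contDiff {p : ℝ → ℝ} (hp : ContDiff ℝ ∞ p) : ContDiff ℝ ∞ (deriv p) :=
  (contDiff_infty_iff_deriv.1 hp).2

lemma lap_radial {p : ℝ → ℝ} (hp : ContDiff ℝ ∞ p) :
    lap n (fun z => p (‖z‖ ^ 2))
      = fun z => 2 * n * deriv p (‖z‖ ^ 2) + 4 * ‖z‖ ^ 2 * deriv (deriv p) (‖z‖ ^ 2) := by
  have hp' := contDiff_deriv_of_contDiff hp
  have hr : Differentiable ℝ fun z : Euc n => deriv p (‖z‖ ^ 2) :=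
    (contDiff_radial hp').differentiable (by simp)
  funext z
  have h : ∀ i, pder n (pder n (fun z => p (‖z‖ ^ 2)) i) i z
      = 2 * deriv p (‖z‖ ^ 2) + 4 * (z i) ^ 2 * deriv (deriv p) (‖z‖ ^ 2) := by
    intro i
    rw [pder_radial (hp.differentiable (by simp)), pder_coord_mul (hr.const_mul 2),
      pder_const_mul hr, pder_radial (hp'.differentiable (by simp))]
    simp only [if_true]
    ring
  have h2 : lap n (fun z => p (‖z‖ ^ 2)) z = ∑ i, pder n (pder n (fun z => p (‖z‖ ^ 2)) i) i z := rfl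
  rw [h2, Finset.sum_congr rfl fun i _ => h i, Finset.sum_add_distrib,
    ← Finset.sum_mul (f := fun i => 4 * (z i) ^ 2), ← Finset.mul_sum, ← Finset.mul_sum,
    ← EuclideanSpace.real_norm_sq_eq, Finset.sum_const, Finset.card_univ,
    Fintype.card_fin, nsmul_eq_mul]
  ring

/-- A smooth function on the line which agrees with a negative power far out. -/
lemma exists_contDiff_eq_rpow_neg (N : ℝ) :
    ∃ p : ℝ → ℝ, ContDiff ℝ ∞ p ∧ ∀ t, 2 ≤ t → p t = t ^ (-N) := by
  refine ⟨fun t => Real.smoothTransition (t - 1) * t ^ (-N), contDiff_iff_contDiffAt.2 fun t => ?_,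
    fun t ht => by
      simp [Real.smoothTransition.one_of_one_le (show 1 ≤ t - 1 by linarith)]⟩
  rcases lt_or_ge t 1 with h | h
  · refine (contDiffAt_const (c := (0:ℝ))).congr_of_eventuallyEq ?_
    filter_upwards [Iio_mem_nhds h] with u hu
    rw [Real.smoothTransition.zero_of_nonpos (by simpa using (Set.mem_Iio.1 hu).le), zero_mul]
  · exact (Real.smoothTransition.contDiff.comp (contDiff_id.sub contDiff_const)).contDiffAt.mul
      (Real.contDiffAt_rpow_const_of_ne (by linarith))

end Radial

section LaplaceProfile

variable {n : ℕ}

lemma deriv_of_eq_rpow_neg {p : ℝ → ℝ} {N : ℝ} (hp : ∀ t, 2 ≤ t → p t = t ^ (-N)) {t : ℝ}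
    (ht : 2 < t) : deriv p t = -N * t ^ (-N - 1) := by
  have h : p =ᶠ[𝓝 t] fun u => u ^ (-N) := by
    filter_upwards [Ioi_mem_nhds ht] with u hu using hp u hu.le
  rw [h.deriv_eq, Real.deriv_rpow_const]

lemma deriv_deriv_of_eq_rpow_neg {p : ℝ → ℝ} {N : ℝ} (hp : ∀ t, 2 ≤ t → p t = t ^ (-N)) {t : ℝ}
    (ht : 2 < t) : deriv (deriv p) t = N * (N + 1) * t ^ (-N - 2) := by
  have h : deriv p =ᶠ[𝓝 t] fun u => -N * u ^ (-N - 1) := by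
    filter_upwards [Ioi_mem_nhds ht] with u hu using deriv_of_eq_rpow_neg hp hu
  rw [h.deriv_eq, deriv_const_mul _ (Real.differentiableAt_rpow_const_of_ne _ (by linarith)),
    Real.deriv_rpow_const, show -N - 1 - 1 = -N - 2 by ring]
  ring

/-- Harmonicity of the fundamental solution, in terms of its radial profile. -/
lemma radial_laplace_eq_zero {p : ℝ → ℝ}
    (hp : ∀ t, 2 ≤ t → p t = t ^ (-((n:ℝ) / 2 - 1))) {t : ℝ} (ht : 2 < t) :
    2 * n * deriv p t + 4 * t * deriv (deriv p) t = 0 := by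
  have h0 : 0 < t := by linarith
  rw [deriv_of_eq_rpow_neg hp ht, deriv_deriv_of_eq_rpow_neg hp ht]
  set N := (n:ℝ) / 2 - 1 with hN
  have hn : (n:ℝ) = 2 * (N + 1) := by rw [hN]; ring
  rw [show -N - 1 = (-N - 2) + 1 by ring, Real.rpow_add h0, Real.rpow_one, hn]
  ring

lemma integral_lap_radial_ne_zero (hn : 3 ≤ n) {p : ℝ → ℝ} (hps : ContDiff ℝ ∞ p)
    (hp : ∀ t, 2 ≤ t → p t = t ^ (-((n:ℝ) / 2 - 1))) :
    ∫ z : Euc n, lap n (fun z => p (‖z‖ ^ 2)) z ≠ 0 := by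
  have hp1 := contDiff_deriv_of_contDiff hps
  have hp2 := contDiff_deriv_of_contDiff hp1
  have : Nonempty (Fin n) := ⟨⟨0, by omega⟩⟩
  set w : ℝ → ℝ := fun y => 2 * n * deriv p (y ^ 2) + 4 * y ^ 2 * deriv (deriv p) (y ^ 2) with hw
  have hN : (0:ℝ) < n / 2 - 1 := by
    have : (3:ℝ) ≤ n := by exact_mod_cast hn
    linarith
  have hwc : Continuous w := by
    have h1 := hp1.continuous
    have h2 := hp2.continuous
    fun_prop
  have hw0 : ∀ y, y ∉ Set.Icc (-2:ℝ) 2 → w y = 0 := by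
    intro y hy
    refine radial_laplace_eq_zero hp ?_
    have : ¬ |y| ≤ 2 := fun h => hy (abs_le.1 h)
    have h2 : 2 < |y| := not_le.1 this
    nlinarith [sq_abs y]
  have hint : IntegrableOn (fun y => y ^ (n - 1) * w y) (Set.Ioi 0) := by
    refine (Continuous.integrable_of_hasCompactSupport (by fun_prop) ?_).integrableOn
    refine HasCompactSupport.intro (isCompact_Icc (a := (-2:ℝ)) (b := 2)) fun y hy => ?_
    rw [hw0 y hy, mul_zero]
  have hder : ∀ y ∈ Set.Ici (0:ℝ),
      HasDerivAt (fun y => 2 * (y ^ n * deriv p (y ^ 2))) (y ^ (n - 1) * w y) y := by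
    intro y _
    have h1 := (hp1.differentiable (by simp) (y ^ 2)).hasDerivAt.comp y (hasDerivAt_pow 2 y)
    have h2 := ((hasDerivAt_pow n y).mul h1).const_mul 2
    refine h2.congr_deriv ?_
    obtain ⟨l, rfl⟩ : ∃ l, n = l + 1 := ⟨n - 1, by omega⟩
    simp only [hw, Nat.add_sub_cancel, Function.comp]
    push_cast
    ring
  have hlim : Tendsto (fun y => 2 * (y ^ n * deriv p (y ^ 2))) atTop
      (𝓝 (-2 * ((n:ℝ) / 2 - 1))) := by
    refine tendsto_const_nhds.congr' ?_
    filter_upwards [eventually_gt_atTop 2] with y hy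
    have hy0 : 0 < y := by linarith
    rw [deriv_of_eq_rpow_neg hp (by nlinarith), ← Real.rpow_two, ← Real.rpow_mul hy0.le,
      show (2:ℝ) * (-((n:ℝ) / 2 - 1) - 1) = -n by ring, Real.rpow_neg hy0.le, Real.rpow_natCast]
    field_simp
  have h1 := integral_Ioi_of_hasDerivAt_of_tendsto' hder hint hlim
  have h2 := integral_fun_norm_addHaar (volume : Measure (Euc n)) w
  rw [lap_radial hps]
  change ∫ z : Euc n, w ‖z‖ ≠ 0
  rw [h2]
  simp only [finrank_euclideanSpace, Fintype.card_fin, smul_eq_mul, nsmul_eq_mul]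
  rw [h1]
  have hball : 0 < volume.real (Metric.ball (0 : Euc n) 1) :=
    ENNReal.toReal_pos (Metric.measure_ball_pos _ _ one_pos).ne' measure_ball_lt_top.ne
  have hn0 : (n:ℝ) ≠ 0 := by positivity
  have hn0' : n ≠ 0 := by omega
  simp only [zero_pow hn0', zero_mul, mul_zero, sub_zero]
  refine mul_ne_zero hn0 (mul_ne_zero hball.ne' ?_)
  linarith

/-- A compactly supported smooth function whose Laplacian is the difference of two scales of a
bump with nonzero integral. -/
lemma exists_laplace_profile (hn : 3 ≤ n) :
    ∃ ψ θ : Euc n → ℝ, ContDiff ℝ ∞ ψ ∧ ContDiff ℝ ∞ θ ∧ (∀ z, 3 < ‖z‖ → ψ z = 0) ∧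
      (∀ z, 3 < ‖z‖ → θ z = 0) ∧ (∀ j k z, z k * pder n ψ j z = z j * pder n ψ k z) ∧
      (∀ z, lap n ψ z = θ z - ((2:ℝ) ^ n)⁻¹ * θ ((2:ℝ)⁻¹ • z)) ∧ ∫ z, θ z ≠ 0 := by
  obtain ⟨p, hps, hp⟩ := exists_contDiff_eq_rpow_neg ((n:ℝ) / 2 - 1)
  have hpd : Differentiable ℝ p := hps.differentiable (by simp)
  have hps1 := contDiff_deriv_of_contDiff hps
  set c : ℝ := 4 * ((2:ℝ) ^ n)⁻¹ with hc
  set P : ℝ → ℝ := fun t => p t - c * p (4⁻¹ * t) with hP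
  have hPs : ContDiff ℝ ∞ P :=
    hps.sub (contDiff_const.mul (hps.comp (contDiff_const.mul contDiff_id)))
  have hd : ∀ {u : ℝ → ℝ}, Differentiable ℝ u → ∀ t, HasDerivAt (fun t => u (4⁻¹ * t))
      (deriv u (4⁻¹ * t) * 4⁻¹) t := fun {u} hu t => by
    have h := (hasDerivAt_id t).const_mul (4⁻¹ : ℝ)
    simpa [Function.comp_def] using (hu (4⁻¹ * t)).hasDerivAt.comp t h
  have hP1 : deriv P = fun t => deriv p t - c * (deriv p (4⁻¹ * t) * 4⁻¹) := by
    funext t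
    exact ((hpd t).hasDerivAt.sub ((hd hpd t).const_mul c)).deriv
  have hpd1 : Differentiable ℝ (deriv p) := hps1.differentiable (by simp)
  have hP2 : deriv (deriv P) = fun t => deriv (deriv p) t
      - c * (deriv (deriv p) (4⁻¹ * t) * 4⁻¹ * 4⁻¹) := by
    funext t
    rw [hP1]
    exact ((hpd1 t).hasDerivAt.sub (((hd hpd1 t).mul_const 4⁻¹).const_mul c)).deriv
  refine ⟨fun z => P (‖z‖ ^ 2), lap n fun z => p (‖z‖ ^ 2), contDiff_radial hPs,
    contDiff_lap (contDiff_radial hps), fun z hz => ?_, fun z hz => ?_, fun j k z => ?_,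
    fun z => ?_, integral_lap_radial_ne_zero hn hps hp⟩
  · have ht : 8 ≤ ‖z‖ ^ 2 := by nlinarith
    set t := ‖z‖ ^ 2
    have ht0 : 0 < t := by linarith
    have h4 : ((4:ℝ)⁻¹) ^ (-((n:ℝ) / 2 - 1)) = 4⁻¹ * (2:ℝ) ^ n := by
      rw [Real.inv_rpow (by norm_num), ← Real.rpow_neg (by norm_num), neg_neg,
        show (4:ℝ) = 2 ^ (2:ℝ) by norm_num, ← Real.rpow_mul (by norm_num),
        show (2:ℝ) * ((n:ℝ) / 2 - 1) = n - 2 by ring, Real.rpow_sub (by norm_num),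
        Real.rpow_natCast]
      ring
    simp only [hP]
    rw [hp t (by linarith), hp (4⁻¹ * t) (by linarith), Real.mul_rpow (by norm_num) ht0.le, h4, hc]
    have h2 : (2:ℝ) ^ n ≠ 0 := by positivity
    field_simp
    ring
  · rw [lap_radial hps]
    exact radial_laplace_eq_zero hp (by nlinarith)
  · rw [pder_radial (hPs.differentiable (by simp)), pder_radial (hPs.differentiable (by simp))]
    ring
  · have hz : ‖(2:ℝ)⁻¹ • z‖ ^ 2 = 4⁻¹ * ‖z‖ ^ 2 := by
      rw [norm_smul, mul_pow]; norm_num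
    rw [lap_radial hPs, lap_radial hps, hP2, hP1]
    simp only [hz, hc]
    ring

end LaplaceProfile

section VectorProfile

variable {n : ℕ}

lemma tsupport_subset_closedBall_of_eq_zero {f : Euc n → ℝ} {r : ℝ}
    (h : ∀ z, r < ‖z‖ → f z = 0) : tsupport f ⊆ Metric.closedBall 0 r := by
  refine closure_minimal (fun z hz => ?_) Metric.isClosed_closedBall
  by_contra hz2
  exact hz (h z (by simpa using hz2))

lemma pder_eq_zero_of_eq_zero {f : Euc n → ℝ} {r : ℝ}
    (h : ∀ z, r < ‖z‖ → f z = 0) (j : Fin n) (z : Euc n) (hz : r < ‖z‖) : pder n f j z = 0 := by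
  refine image_eq_zero_of_notMem_tsupport fun h2 => ?_
  have := tsupport_subset_closedBall_of_eq_zero h (tsupport_pder_subset f j h2)
  rw [mem_closedBall_zero_iff] at this
  linarith

lemma pder_comp_smul (f : Euc n → ℝ) (c : ℝ) (j : Fin n) :
    pder n (fun z => f (c • z)) j = fun z => c * pder n f j (c • z) := by
  funext z
  simp only [pder]
  rw [fderiv_comp_smul]
  rfl

lemma integral_coord_mul_pder {f : Euc n → ℝ} (hf : ContDiff ℝ ∞ f) (hc : HasCompactSupport f)
    (j k : Fin n) :
    ∫ z : Euc n, z k * pder n f j z = -((if j = k then 1 else 0) * ∫ z, f z) := by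
  have hco : ∀ z, fderiv ℝ (fun z : Euc n => z k) z (EuclideanSpace.single j 1)
      = if j = k then 1 else 0 := by
    intro z
    rw [show (fun z : Euc n => z k) = (EuclideanSpace.proj k : Euc n →L[ℝ] ℝ) from rfl,
      ContinuousLinearMap.fderiv]
    simp [eq_comm]
  have hpc : Continuous (fun z : Euc n => z k) := by fun_prop
  have h := integral_mul_fderiv_eq_neg_fderiv_mul_of_integrable (μ := (volume : Measure (Euc n)))
    (f := fun z : Euc n => z k) (g := f) (v := EuclideanSpace.single j 1) ?_ ?_ ?_ ?_ ?_
  · simp only [hco, integral_const_mul] at h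
    exact h
  · simp only [hco]
    exact (hf.continuous.integrable_of_hasCompactSupport hc).const_mul _
  · exact (hpc.mul (contDiff_pder hf j).continuous).integrable_of_hasCompactSupport
      (hasCompactSupport_pder hc j).mul_left
  · exact (hpc.mul hf.continuous).integrable_of_hasCompactSupport hc.mul_left
  · exact fun z _ => (EuclideanSpace.proj k : Euc n →L[ℝ] ℝ).differentiableAt
  · exact fun z _ => (hf.differentiable (by simp)) z

/-- A matrix of compactly supported profiles `Ψ` which the vector Laplacian turns into the
difference of two scales of a matrix of bumps `Χ` with nonzero scalar integral. -/
def IsVectorProfile (n : ℕ) (m₀ : ℝ) (Ψ Χ : Fin n → Fin n → Euc n → ℝ) : Prop :=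
  m₀ ≠ 0 ∧ (∀ j k, ContDiff ℝ ∞ (Ψ j k)) ∧ (∀ j k, ContDiff ℝ ∞ (Χ j k)) ∧
    (∀ j k, tsupport (Ψ j k) ⊆ Metric.closedBall 0 3) ∧
    (∀ j k, tsupport (Χ j k) ⊆ Metric.closedBall 0 3) ∧
    (∀ j k, Ψ j k = Ψ k j) ∧
    (∀ j k, ∫ z, Χ j k z = if j = k then m₀ else 0) ∧
    (∀ j k z, -(1 / 2) * ∑ i, pder n (pder n (Ψ j k) i) i z
        - ((n:ℝ) - 2) / (2 * n) * ∑ i, pder n (pder n (Ψ i k) i) j z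
      = Χ j k z - ((2:ℝ) ^ n)⁻¹ * Χ j k ((2:ℝ)⁻¹ • z))

lemma exists_vector_profile (hn : 3 ≤ n) : ∃ m₀ Ψ Χ, IsVectorProfile n m₀ Ψ Χ := by
  obtain ⟨ψ, θ, hψ, hθ, hψ0, hθ0, hsymm, hlap, hint⟩ := exists_laplace_profile hn
  have hd : ∀ {u : Euc n → ℝ}, ContDiff ℝ ∞ u → Differentiable ℝ u :=
    fun hu => hu.differentiable (by simp)
  set c : ℝ := ((n:ℝ) - 2) / (2 * n) with hc
  have hc0 : 0 ≤ c := by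
    have : (3:ℝ) ≤ n := by exact_mod_cast hn
    exact div_nonneg (by linarith) (by positivity)
  set δ : Fin n → Fin n → ℝ := fun j k => if j = k then 1 else 0 with hδ
  have hδc : ∀ j k, δ j k = δ k j := fun j k => by simp only [hδ, eq_comm]
  set κ : ℝ := -(1 + c) / 2 + c ^ 2 with hκ
  set l : ℝ := c * (1 / 2 + c) with hl
  set Ψ : Fin n → Fin n → Euc n → ℝ := fun j k z =>
    (1 + c) * δ j k * ψ z + (-c) * (z k * pder n ψ j z) with hΨ
  set Χ : Fin n → Fin n → Euc n → ℝ := fun j k z =>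
    κ * δ j k * θ z + l * (z k * pder n θ j z) with hΧ
  have hθc : HasCompactSupport θ :=
    hasCompactSupport_of_tsupport_subset_closedBall (tsupport_subset_closedBall_of_eq_zero hθ0)
  have hlapψ : ContDiff ℝ ∞ (lap n ψ) := contDiff_lap hψ
  have hzp : ∀ j k, ContDiff ℝ ∞ fun z : Euc n => z k * pder n ψ j z :=
    fun j k => contDiff_coord_mul (contDiff_pder hψ j) k
  have hΨs : ∀ j k, ContDiff ℝ ∞ (Ψ j k) := fun j k =>
    (contDiff_const.mul hψ).add (contDiff_const.mul (hzp j k))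
  have hlapΨ : ∀ j k z, ∑ i, pder n (pder n (Ψ j k) i) i z
      = (1 + c) * δ j k * lap n ψ z
        + (-c) * (2 * pder n (pder n ψ j) k z + z k * pder n (lap n ψ) j z) := by
    intro j k z
    have h1 : ∀ i, pder n (pder n (Ψ j k) i) i z
        = (1 + c) * δ j k * pder n (pder n ψ i) i z
          + (-c) * pder n (pder n (fun z => z k * pder n ψ j z) i) i z := by
      intro i
      simp only [hΨ]
      rw [pder_add ((hd hψ).const_mul _) ((hd (hzp j k)).const_mul _),
        pder_const_mul (hd hψ), pder_const_mul (hd (hzp j k)),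
        pder_add ((hd (contDiff_pder hψ i)).const_mul _)
          ((hd (contDiff_pder (hzp j k) i)).const_mul _),
        pder_const_mul (hd (contDiff_pder hψ i)), pder_const_mul (hd (contDiff_pder (hzp j k) i))]
    rw [Finset.sum_congr rfl fun i _ => h1 i, Finset.sum_add_distrib, ← Finset.mul_sum,
      ← Finset.mul_sum]
    have h2 := congrFun (lap_coord_mul (contDiff_pder hψ j) k) z
    rw [lap_pder hψ] at h2
    rw [← h2]
    rfl
  have hdiv : ∀ k, (fun z => ∑ i, pder n (Ψ i k) i z)
      = fun z => pder n ψ k z + (-c) * (z k * lap n ψ z) := by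
    intro k
    funext z
    have h1 : ∀ i, pder n (Ψ i k) i z = (1 + c) * (δ i k * pder n ψ i z)
        + (-c) * (δ i k * pder n ψ i z + z k * pder n (pder n ψ i) i z) := by
      intro i
      simp only [hΨ]
      rw [pder_add ((hd hψ).const_mul _) ((hd (hzp i k)).const_mul _),
        pder_const_mul (hd hψ), pder_const_mul (hd (hzp i k)),
        pder_coord_mul (hd (contDiff_pder hψ i))]
      simp only [hδ]
      ring
    rw [Finset.sum_congr rfl fun i _ => h1 i, Finset.sum_add_distrib, ← Finset.mul_sum,
      ← Finset.mul_sum, Finset.sum_add_distrib, ← Finset.mul_sum]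
    simp only [hδ, ite_mul, one_mul, zero_mul, Finset.sum_ite_eq', Finset.mem_univ, if_true]
    change _ = pder n ψ k z + (-c) * (z k * ∑ i, pder n (pder n ψ i) i z)
    ring
  have hgraddiv : ∀ j k z, ∑ i, pder n (pder n (Ψ i k) i) j z
      = pder n (pder n ψ k) j z + (-c) * (δ j k * lap n ψ z + z k * pder n (lap n ψ) j z) := by
    intro j k z
    have h1 := pder_sum Finset.univ (fun i => hd (contDiff_pder (hΨs i k) i)) j
    rw [← congrFun h1 z, hdiv k,
      pder_add (hd (contDiff_pder hψ k)) ((hd (contDiff_coord_mul hlapψ k)).const_mul _),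
      pder_const_mul (hd (contDiff_coord_mul hlapψ k)), pder_coord_mul (hd hlapψ)]
  have hθ2 : Differentiable ℝ fun z : Euc n => θ ((2:ℝ)⁻¹ • z) :=
    hd (hθ.comp (contDiff_const_smul _))
  have hpl : ∀ j, pder n (lap n ψ) j = fun z =>
      pder n θ j z - ((2:ℝ) ^ n)⁻¹ * ((2:ℝ)⁻¹ * pder n θ j ((2:ℝ)⁻¹ • z)) := by
    intro j
    rw [show lap n ψ = fun z => θ z - ((2:ℝ) ^ n)⁻¹ * θ ((2:ℝ)⁻¹ • z) from funext hlap,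
      pder_sub (hd hθ) (hθ2.const_mul _), pder_const_mul hθ2, pder_comp_smul]
  refine ⟨-(1 + 2 * c) / 2 * ∫ z, θ z, Ψ, Χ, ?_, hΨs, fun j k => ?_, fun j k => ?_, fun j k => ?_,
    fun j k => ?_, fun j k => ?_, fun j k z => ?_⟩
  · exact mul_ne_zero (by linarith) hint
  · exact (contDiff_const.mul hθ).add
      (contDiff_const.mul (contDiff_coord_mul (contDiff_pder hθ j) k))
  · refine tsupport_subset_closedBall_of_eq_zero fun z hz => ?_
    simp only [hΨ]
    rw [hψ0 z hz, pder_eq_zero_of_eq_zero hψ0 j z hz]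
    ring
  · refine tsupport_subset_closedBall_of_eq_zero fun z hz => ?_
    simp only [hΧ]
    rw [hθ0 z hz, pder_eq_zero_of_eq_zero hθ0 j z hz]
    ring
  · funext z
    simp only [hΨ]
    rw [hsymm, hδc]
  · simp only [hΧ]
    have hi1 : Integrable θ := hθ.continuous.integrable_of_hasCompactSupport hθc
    have hi2 : Integrable fun z : Euc n => z k * pder n θ j z :=
      (contDiff_coord_mul (contDiff_pder hθ j) k).continuous.integrable_of_hasCompactSupport
        (hasCompactSupport_pder hθc j).mul_left
    rw [integral_add (hi1.const_mul _) (hi2.const_mul _), integral_const_mul, integral_const_mul,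
      integral_coord_mul_pder hθ hθc]
    simp only [hδ]
    split_ifs
    · rw [hκ, hl]; ring
    · ring
  · rw [hlapΨ, hgraddiv, hpl,
      pder_comm (by exact_mod_cast contDiff_infty.1 hψ 2 : ContDiff ℝ 2 ψ) j k, hlap]
    simp only [hΧ, hκ, hl, PiLp.smul_apply, smul_eq_mul]
    ring

end VectorProfile

section Telescoping

variable {n : ℕ}

lemma hasSum_int_telescope {G : ℤ → ℝ} {S a b : ℝ} (h : HasSum (fun j => G j - G (j + 1)) S)
    (ha : Tendsto G atBot (𝓝 a)) (hb : Tendsto G atTop (𝓝 b)) : S = a - b := by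
  have hset : Tendsto (fun N : ℕ => Finset.Ico (-(N:ℤ)) N) atTop atTop := by
    refine tendsto_atTop_finset_of_monotone (fun N N' hN => ?_) fun j => ⟨j.natAbs + 1, ?_⟩
    · have : (N:ℤ) ≤ N' := by exact_mod_cast hN
      exact Finset.Ico_subset_Ico (by omega) this
    · simp only [Finset.mem_Ico]
      omega
  have hpart : ∀ N : ℕ, ∑ j ∈ Finset.Ico (-(N:ℤ)) N, (G j - G (j + 1)) = G (-(N:ℤ)) - G N := by
    intro N
    have : ∀ (M : ℕ) (u : ℤ), ∑ j ∈ Finset.Ico u (u + M), (G j - G (j + 1)) = G u - G (u + M) := by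
      intro M u
      induction M with
      | zero => simp
      | succ M ih =>
        have hu : u + ((M + 1 : ℕ) : ℤ) = u + M + 1 := by push_cast; ring
        rw [hu, ← Finset.insert_Ico_right_eq_Ico_add_one (by omega),
          Finset.sum_insert Finset.right_notMem_Ico, ih]
        ring
    have h2 := this (2 * N) (-(N:ℤ))
    have e : -(N:ℤ) + ((2 * N : ℕ) : ℤ) = N := by push_cast; ring
    rwa [e] at h2
  have hN : Tendsto (fun N : ℕ => (N : ℤ)) atTop atTop := tendsto_natCast_atTop_atTop
  have h1 : Tendsto (fun N : ℕ => G (-(N:ℤ)) - G N) atTop (𝓝 S) := by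
    simpa only [Function.comp_def, hpart] using h.comp hset
  exact tendsto_nhds_unique h1
    ((ha.comp (tendsto_neg_atTop_atBot.comp hN)).sub (hb.comp hN))

lemma tendsto_two_zpow_atBot : Tendsto (fun j : ℤ => (2:ℝ) ^ j) atBot (𝓝 0) := by
  have h : Tendsto (fun j : ℤ => (2:ℝ) ^ (j : ℝ)) atBot (𝓝 0) :=
    (tendsto_rpow_atBot_of_base_gt_one 2 one_lt_two).comp
      (tendsto_intCast_atBot_iff.2 tendsto_id)
  simpa only [Real.rpow_intCast] using h

lemma tendsto_two_zpow_atTop : Tendsto (fun j : ℤ => (2:ℝ) ^ j) atTop atTop := by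
  have h : Tendsto (fun j : ℤ => (2:ℝ) ^ (j : ℝ)) atTop atTop :=
    (tendsto_rpow_atTop_of_base_gt_one 2 one_lt_two).comp tendsto_intCast_atTop_atTop
  simpa only [Real.rpow_intCast] using h

lemma tendsto_kerAvg_atBot {A : Euc n → ℝ} (hA : Continuous A) (hc : HasCompactSupport A)
    {g : Euc n → ℝ} (hg : Continuous g) (x : Euc n) :
    Tendsto (fun j : ℤ => kerAvg n A ((2:ℝ) ^ j) g x) atBot (𝓝 ((∫ z, A z) * g x)) := by
  have h0 : (fun s : ℝ => kerAvg n A s g x)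
      = fun s => ∫ z in tsupport A, A z • g (x - s • z) := by
    funext s
    refine (setIntegral_eq_integral_of_forall_compl_eq_zero fun z hz => ?_).symm
    rw [image_eq_zero_of_notMem_tsupport hz, zero_smul]
  have hcont : Continuous fun s : ℝ => kerAvg n A s g x := by
    rw [h0]
    exact continuous_parametric_integral_of_continuous (by fun_prop) hc.isCompact
  have h1 := (hcont.tendsto 0).comp tendsto_two_zpow_atBot
  have h2 : kerAvg n A 0 g x = (∫ z, A z) * g x := by
    simp only [kerAvg, zero_smul, sub_zero, smul_eq_mul, integral_mul_const]
  rwa [h2] at h1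

lemma tendsto_kerAvg_atTop (hn : 1 ≤ n) {ν : ℝ} (hν0 : 0 < ν) (hν : ν < n)
    {A : Euc n → ℝ} (hA : ContDiff ℝ ∞ A) {r : ℝ} (hr : tsupport A ⊆ Metric.closedBall 0 r)
    {g : Euc n → ℝ} (hg : Continuous g) {M : ℝ} (hM : 0 ≤ M)
    (hgM : ∀ y, ‖g y‖ ≤ M * (1 + ‖y‖) ^ (-ν)) (x : Euc n) :
    Tendsto (fun j : ℤ => kerAvg n A ((2:ℝ) ^ j) g x) atTop (𝓝 0) := by
  obtain ⟨K, hK, h⟩ := exists_norm_iteratedFDeriv_kerAvg_le_rpow (E := ℝ) hn hν0.le hν hA hr 0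
  have h1 : Tendsto (fun j : ℤ => K * M * ((2:ℝ) ^ j) ^ (-ν)) atTop (𝓝 (K * M * 0)) :=
    ((tendsto_rpow_neg_atTop hν0).comp tendsto_two_zpow_atTop).const_mul _
  rw [mul_zero] at h1
  refine squeeze_zero_norm (fun j => ?_) h1
  simpa using h g M hg hM hgM ((2:ℝ) ^ j) (by positivity) x

lemma kerAvg_rescale (A : Euc n → ℝ) (s : ℝ) (g : Euc n → ℝ) (x : Euc n) :
    kerAvg n (fun z => ((2:ℝ) ^ n)⁻¹ * A ((2:ℝ)⁻¹ • z)) s g x = kerAvg n A (2 * s) g x := by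
  have h := Measure.integral_comp_smul (volume : Measure (Euc n))
    (fun y => A y * g (x - (2 * s) • y)) ((2:ℝ)⁻¹)
  simp only [finrank_euclideanSpace, Fintype.card_fin, smul_smul] at h
  rw [abs_of_pos (by positivity), mul_assoc 2 s, mul_comm s, ← mul_assoc,
    mul_inv_cancel₀ two_ne_zero, one_mul, inv_pow, inv_inv] at h
  simp only [kerAvg, smul_eq_mul, mul_assoc, integral_const_mul]
  rw [h, smul_eq_mul, ← mul_assoc, inv_mul_cancel₀ (by positivity), one_mul]

end Telescoping

section Averages

variable {n : ℕ}

lemma pder_kerAvg {A : Euc n → ℝ} (hA : ContDiff ℝ ∞ A) (hc : HasCompactSupport A)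
    {g : Euc n → ℝ} (hg : Continuous g) {s : ℝ} (hs : 0 < s) (i : Fin n) :
    pder n (kerAvg n A s g) i = fun x => s⁻¹ * kerAvg n (pder n A i) s g x :=
  funext fun x => fderiv_kerAvg_kernel hA hc hg hs x i

/-- Integration by parts in an average. -/
lemma kerAvg_pder {A : Euc n → ℝ} (hA : ContDiff ℝ ∞ A) (hc : HasCompactSupport A)
    {g : Euc n → ℝ} (hg : ContDiff ℝ 1 g) {s : ℝ} (hs : 0 < s) (i : Fin n) (x : Euc n) :
    kerAvg n A s (pder n g i) x = s⁻¹ * kerAvg n (pder n A i) s g x := by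
  have h1 := (hasFDerivAt_kerAvg hA.continuous hc hg s x).fderiv
  have h2 := fderiv_kerAvg_kernel hA hc hg.continuous hs x i
  rw [h1] at h2
  rw [smul_eq_mul] at h2
  rw [← h2]
  unfold kerAvg
  rw [ContinuousLinearMap.integral_apply
    (integrable_kerAvg hA.continuous hc (hg.continuous_fderiv one_ne_zero) s x)]
  rfl

lemma contDiff_one_pder {g : Euc n → ℝ} (hg : ContDiff ℝ 2 g) (i : Fin n) :
    ContDiff ℝ 1 (pder n g i) :=
  (hg.fderiv_right (m := 1) (by norm_num)).clm_apply contDiff_const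

lemma kerAvg_pder_pder {A : Euc n → ℝ} (hA : ContDiff ℝ ∞ A) (hc : HasCompactSupport A)
    {g : Euc n → ℝ} (hg : ContDiff ℝ 2 g) {s : ℝ} (hs : 0 < s) (i k : Fin n) (x : Euc n) :
    s ^ 2 * kerAvg n A s (pder n (pder n g i) k) x = kerAvg n (pder n (pder n A k) i) s g x := by
  rw [kerAvg_pder hA hc (contDiff_one_pder hg i) hs, kerAvg_pder (contDiff_pder hA k)
    (hasCompactSupport_pder hc k) (hg.of_le (by norm_num)) hs]
  field_simp

lemma pder_pder_dyadTerm {A : Euc n → ℝ} (hA : ContDiff ℝ ∞ A) (hc : HasCompactSupport A)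
    {g : Euc n → ℝ} (hg : Continuous g) (j : ℤ) (a b : Fin n) (x : Euc n) :
    pder n (pder n (dyadTerm n A g j) a) b x
      = kerAvg n (pder n (pder n A a) b) ((2:ℝ) ^ j) g x := by
  have hs : 0 < (2:ℝ) ^ j := by positivity
  have hd : ∀ {B : Euc n → ℝ}, ContDiff ℝ ∞ B → HasCompactSupport B →
      Differentiable ℝ (kerAvg n B ((2:ℝ) ^ j) g) := fun hB hBc =>
    (contDiff_kerAvg hB hBc hg hs).differentiable (by simp)
  have hA1 := contDiff_pder hA a
  have hc1 := hasCompactSupport_pder hc a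
  change pder n (pder n (fun y => ((2:ℝ) ^ j) ^ 2 * kerAvg n A ((2:ℝ) ^ j) g y) a) b x = _
  rw [pder_const_mul (hd hA hc), pder_kerAvg hA hc hg hs,
    pder_const_mul ((hd hA1 hc1).const_mul _), pder_const_mul (hd hA1 hc1),
    pder_kerAvg hA1 hc1 hg hs]
  field_simp

/-- Second derivatives of the dyadic sum. -/
lemma hasSum_pder_pder_dyadSum (hn : 1 ≤ n) {ν α : ℝ} (hν0 : 2 < ν) (hν : ν < n)
    (hα : 0 < α) {A : Euc n → ℝ} (hA : ContDiff ℝ ∞ A) {r : ℝ} (hr0 : 0 < r)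
    (hr : tsupport A ⊆ Metric.closedBall 0 r) {m : ℕ} {f : Euc n → ℝ} {M : ℝ}
    (hf : HolderDecay n m α ν M f) (a b : Fin n) (x : Euc n) :
    HasSum (fun j : ℤ => kerAvg n (pder n (pder n A a) b) ((2:ℝ) ^ j) f x)
      (pder n (pder n (dyadSum n A f) a) b x) := by
  have hc := hasCompactSupport_of_tsupport_subset_closedBall hr
  obtain ⟨v, hv⟩ := exists_summable_bound_dyadTerm hn hν0 hν hα hA hr0 hr hf
  obtain ⟨hv2, hle⟩ := hv 2 (by omega)
  obtain ⟨hsm, hD⟩ := contDiff_dyadSum hn hν0 hν hα hA hr0 hr hf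
  have hsm2 : ContDiff ℝ 2 (dyadSum n A f) := hsm.of_le (by exact_mod_cast (by omega : 2 ≤ m + 2))
  have hsum : Summable fun j => iteratedFDeriv ℝ 2 (dyadTerm n A f j) x :=
    Summable.of_norm_bounded hv2 fun j => hle j x
  have h1 := hsum.hasSum
  rw [← hD 2 (by omega) x] at h1
  have h2 := h1.mapL (ContinuousMultilinearMap.apply ℝ (fun _ : Fin 2 => Euc n) ℝ
    ![EuclideanSpace.single b 1, EuclideanSpace.single a 1])
  simp only [ContinuousMultilinearMap.apply_apply] at h2
  rw [pder_pder_eq hsm2]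
  refine h2.congr_fun ?_
  intro j
  have : ContDiff ℝ 2 (dyadTerm n A f j) := by
    exact_mod_cast contDiff_infty.1 (contDiff_dyadTerm hA hc hf.1.continuous j) 2
  rw [← pder_pder_eq this, pder_pder_dyadTerm hA hc hf.1.continuous]

lemma hasSum_dyadSum (hn : 1 ≤ n) {ν α : ℝ} (hν0 : 2 < ν) (hν : ν < n)
    (hα : 0 < α) {A : Euc n → ℝ} (hA : ContDiff ℝ ∞ A) {r : ℝ} (hr0 : 0 < r)
    (hr : tsupport A ⊆ Metric.closedBall 0 r) {m : ℕ} {f : Euc n → ℝ} {M : ℝ}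
    (hf : HolderDecay n m α ν M f) (x : Euc n) :
    HasSum (fun j : ℤ => dyadTerm n A f j x) (dyadSum n A f x) := by
  obtain ⟨v, hv⟩ := exists_summable_bound_dyadTerm hn hν0 hν hα hA hr0 hr hf
  obtain ⟨hv0, hle⟩ := hv 0 (by omega)
  exact (Summable.of_norm_bounded hv0 fun j => by simpa using hle j x).hasSum

end Averages

section Operator

variable {n : ℕ}

/-- `LX = -½ΔX - ((n-2)/(2n))∇(div X)` for vector fields of class `C²`. -/
lemma vLap_eq (hn : n ≠ 0) {X : Euc n → Euc n} (hX : ∀ j, ContDiff ℝ 2 fun y => X y j)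
    (x : Euc n) (j : Fin n) :
    vLap n X x j = -(1 / 2) * ∑ i, pder n (pder n (fun y => X y j) i) i x
      - ((n:ℝ) - 2) / (2 * n) * ∑ i, pder n (pder n (fun y => X y i) i) j x := by
  have hd : ∀ a b, Differentiable ℝ (pder n (fun y => X y a) b) :=
    fun a b => differentiable_pder (hX a) b
  have hdiv : Differentiable ℝ (divg n X) :=
    Differentiable.fun_sum fun i _ => hd i i
  have hcoef : ∀ k, pder n (fun y => confKill n X y j k) k x
      = 1 / 2 * (pder n (pder n (fun y => X y k) k) j x
          + pder n (pder n (fun y => X y j) k) k x)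
        - (if j = k then 1 / (n:ℝ) * pder n (divg n X) k x else 0) := by
    intro k
    have e : (fun y => confKill n X y j k)
        = fun y => 1 / 2 * (pder n (fun y => X y k) j y + pder n (fun y => X y j) k y)
          - (1 / (n:ℝ) * if j = k then 1 else 0) * divg n X y := by
      funext y
      simp only [confKill]
      ring
    rw [e, pder_sub (((hd k j).fun_add (hd j k)).const_mul _) (hdiv.const_mul _),
      pder_const_mul ((hd k j).fun_add (hd j k)), pder_add (hd k j) (hd j k), pder_const_mul hdiv,
      pder_comm (hX k) j k]
    split_ifs <;> ring
  have hgrad : pder n (divg n X) j x = ∑ i, pder n (pder n (fun y => X y i) i) j x :=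
    congrFun (pder_sum Finset.univ (fun i => hd i i) j) x
  rw [vLap]
  simp only [hcoef, Finset.sum_sub_distrib, ← Finset.mul_sum, Finset.sum_add_distrib,
    Finset.sum_ite_eq, Finset.mem_univ, if_true, hgrad]
  have : (n:ℝ) ≠ 0 := by exact_mod_cast hn
  field_simp
  ring

lemma kerAvg_combination_left {A B : Fin n → Euc n → ℝ} (hA : ∀ i, Continuous (A i))
    (hAc : ∀ i, HasCompactSupport (A i)) (hB : ∀ i, Continuous (B i))
    (hBc : ∀ i, HasCompactSupport (B i)) {g : Euc n → ℝ} (hg : Continuous g) (a b s : ℝ)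
    (x : Euc n) :
    kerAvg n (fun z => a * ∑ i, A i z - b * ∑ i, B i z) s g x
      = a * ∑ i, kerAvg n (A i) s g x - b * ∑ i, kerAvg n (B i) s g x := by
  have h1 := fun i => integrable_kerAvg (hA i) (hAc i) hg s x
  have h2 := fun i => integrable_kerAvg (hB i) (hBc i) hg s x
  simp only [kerAvg]
  rw [← integral_finsetSum _ fun i _ => h1 i, ← integral_finsetSum _ fun i _ => h2 i,
    ← integral_const_mul, ← integral_const_mul, ← integral_sub
      ((integrable_finsetSum _ fun i _ => h1 i).const_mul _)
      ((integrable_finsetSum _ fun i _ => h2 i).const_mul _)]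
  refine integral_congr_ae (.of_forall fun z => ?_)
  simp only [smul_eq_mul, sub_mul, mul_assoc, Finset.sum_mul]

lemma kerAvg_combination_right {A : Euc n → ℝ} (hA : Continuous A) (hAc : HasCompactSupport A)
    {u v : Fin n → Euc n → ℝ} (hu : ∀ i, Continuous (u i)) (hv : ∀ i, Continuous (v i))
    (a b s : ℝ) (x : Euc n) :
    kerAvg n A s (fun y => a * ∑ i, u i y - b * ∑ i, v i y) x
      = a * ∑ i, kerAvg n A s (u i) x - b * ∑ i, kerAvg n A s (v i) x := by
  have h1 := fun i => integrable_kerAvg hA hAc (hu i) s x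
  have h2 := fun i => integrable_kerAvg hA hAc (hv i) s x
  simp only [kerAvg]
  rw [← integral_finsetSum _ fun i _ => h1 i, ← integral_finsetSum _ fun i _ => h2 i,
    ← integral_const_mul, ← integral_const_mul, ← integral_sub
      ((integrable_finsetSum _ fun i _ => h1 i).const_mul _)
      ((integrable_finsetSum _ fun i _ => h2 i).const_mul _)]
  refine integral_congr_ae (.of_forall fun z => ?_)
  simp only [smul_eq_mul, mul_sub, Finset.mul_sum]
  congr 1 <;> exact Finset.sum_congr rfl fun i _ => by ring

lemma kerAvg_sub_rescale {A : Euc n → ℝ} (hA : Continuous A) (hAc : HasCompactSupport A)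
    {g : Euc n → ℝ} (hg : Continuous g) (s : ℝ) (x : Euc n) :
    kerAvg n (fun z => A z - ((2:ℝ) ^ n)⁻¹ * A ((2:ℝ)⁻¹ • z)) s g x
      = kerAvg n A s g x - kerAvg n A (2 * s) g x := by
  have hB : Continuous fun z => ((2:ℝ) ^ n)⁻¹ * A ((2:ℝ)⁻¹ • z) := by fun_prop
  have hBc : HasCompactSupport fun z => ((2:ℝ) ^ n)⁻¹ * A ((2:ℝ)⁻¹ • z) :=
    (hAc.comp_smul (inv_ne_zero two_ne_zero)).mul_left
  rw [← kerAvg_rescale A s g x]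
  simp only [kerAvg]
  rw [← integral_sub (integrable_kerAvg hA hAc hg s x) (integrable_kerAvg hB hBc hg s x)]
  simp only [sub_smul]

end Operator

section HolderDecayOperations

variable {n : ℕ} {E E' : Type*} [NormedAddCommGroup E] [NormedSpace ℝ E]
  [NormedAddCommGroup E'] [NormedSpace ℝ E']

lemma HolderDecay.mono {m : ℕ} {α ν M M' : ℝ} {f : Euc n → E} (hf : HolderDecay n m α ν M f)
    (h : M ≤ M') : HolderDecay n m α ν M' f :=
  ⟨hf.1, fun i hi x => (hf.2.1 i hi x).trans (by gcongr),
    fun x y hxy => (hf.2.2 x y hxy).trans (by gcongr)⟩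

lemma HolderDecay.clm_comp {m : ℕ} {α ν M : ℝ} {f : Euc n → E} (hf : HolderDecay n m α ν M f)
    (T : E →L[ℝ] E') : HolderDecay n m α ν (‖T‖ * M) fun x => T (f x) := by
  have hD : ∀ i ≤ m, ∀ x, iteratedFDeriv ℝ i (fun x => T (f x)) x
      = T.compContinuousMultilinearMap (iteratedFDeriv ℝ i f x) := fun i hi x =>
    T.iteratedFDeriv_comp_left hf.1.contDiffAt (by exact_mod_cast hi)
  refine ⟨T.contDiff.comp hf.1, fun i hi x => ?_, fun x y hxy => ?_⟩
  · rw [hD i hi, mul_assoc]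
    exact (T.norm_compContinuousMultilinearMap_le _).trans (by gcongr; exact hf.2.1 i hi x)
  · have e : T.compContinuousMultilinearMap (iteratedFDeriv ℝ m f x)
        - T.compContinuousMultilinearMap (iteratedFDeriv ℝ m f y)
        = T.compContinuousMultilinearMap (iteratedFDeriv ℝ m f x - iteratedFDeriv ℝ m f y) := by
      ext v
      simp
    rw [hD m le_rfl, hD m le_rfl, e, mul_assoc, mul_assoc, ← mul_assoc M]
    exact (T.norm_compContinuousMultilinearMap_le _).trans (by gcongr; exact hf.2.2 x y hxy)

lemma HolderDecay.sum {ι : Type*} (s : Finset ι) {m : ℕ} {α ν : ℝ} {M : ι → ℝ}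
    {f : ι → Euc n → E} (hf : ∀ i, HolderDecay n m α ν (M i) (f i)) :
    HolderDecay n m α ν (∑ i ∈ s, M i) fun x => ∑ i ∈ s, f i x := by
  have hD : ∀ l ≤ m, ∀ x, iteratedFDeriv ℝ l (fun x => ∑ i ∈ s, f i x) x
      = ∑ i ∈ s, iteratedFDeriv ℝ l (f i) x := fun l hl x =>
    iteratedFDeriv_fun_sum_apply fun i _ => ((hf i).1.of_le (by exact_mod_cast hl)).contDiffAt
  refine ⟨ContDiff.sum fun i _ => (hf i).1, fun l hl x => ?_, fun x y hxy => ?_⟩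
  · rw [hD l hl, Finset.sum_mul]
    exact norm_sum_le_of_le _ fun i _ => (hf i).2.1 l hl x
  · rw [hD m le_rfl, hD m le_rfl, ← Finset.sum_sub_distrib, Finset.sum_mul, Finset.sum_mul]
    exact norm_sum_le_of_le _ fun i _ => (hf i).2.2 x y hxy

end HolderDecayOperations

section VectorPotential

variable {n : ℕ}

/-- The vector potential of `F` with profile `Ψ`. -/
def vecPot (n : ℕ) (m₀ : ℝ) (Ψ : Fin n → Fin n → Euc n → ℝ) (F : Euc n → Euc n) (x : Euc n) :
    Euc n :=
  ∑ j, (m₀⁻¹ * ∑ k, dyadSum n (Ψ j k) (fun y => F y k) x) • EuclideanSpace.single j (1:ℝ)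

lemma vecPot_apply (m₀ : ℝ) (Ψ : Fin n → Fin n → Euc n → ℝ) (F : Euc n → Euc n) (x : Euc n)
    (j : Fin n) :
    vecPot n m₀ Ψ F x j = m₀⁻¹ * ∑ k, dyadSum n (Ψ j k) (fun y => F y k) x := by
  simp [vecPot, Pi.single_apply]

variable {m₀ : ℝ} {Ψ Χ : Fin n → Fin n → Euc n → ℝ}

lemma IsVectorProfile.kerAvg_eq (hP : IsVectorProfile n m₀ Ψ Χ) {g : Euc n → ℝ}
    (hg : Continuous g) (s : ℝ) (x : Euc n) (j k : Fin n) :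
    -(1 / 2) * ∑ i, kerAvg n (pder n (pder n (Ψ j k) i) i) s g x
        - ((n:ℝ) - 2) / (2 * n) * ∑ i, kerAvg n (pder n (pder n (Ψ i k) i) j) s g x
      = kerAvg n (Χ j k) s g x - kerAvg n (Χ j k) (2 * s) g x := by
  obtain ⟨-, hΨ, hΧ, hΨ3, hΧ3, -, -, hid⟩ := hP
  have hc := fun a b => hasCompactSupport_of_tsupport_subset_closedBall (hΨ3 a b)
  have h2 : ∀ a b c d, Continuous (pder n (pder n (Ψ a b) c) d) := fun a b c d =>
    (contDiff_pder (contDiff_pder (hΨ a b) c) d).continuous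
  have h2c : ∀ a b c d, HasCompactSupport (pder n (pder n (Ψ a b) c) d) := fun a b c d =>
    hasCompactSupport_pder (hasCompactSupport_pder (hc a b) c) d
  rw [← kerAvg_combination_left (fun i => h2 j k i i) (fun i => h2c j k i i)
    (fun i => h2 i k i j) (fun i => h2c i k i j) hg,
    ← kerAvg_sub_rescale (hΧ j k).continuous
      (hasCompactSupport_of_tsupport_subset_closedBall (hΧ3 j k)) hg]
  simp only [hid]

lemma IsVectorProfile.eq_of_hasSum (hP : IsVectorProfile n m₀ Ψ Χ) (hn : 1 ≤ n) {ν : ℝ}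
    (hν0 : 0 < ν) (hν : ν < n) {g : Fin n → Euc n → ℝ} (hg : ∀ k, Continuous (g k)) {M : ℝ}
    (hM : 0 ≤ M) (hgM : ∀ k y, ‖g k y‖ ≤ M * (1 + ‖y‖) ^ (-ν)) (x : Euc n) (a b : Fin n → Fin n)
    {S : ℝ}
    (h : HasSum (fun l : ℤ => ∑ k, (kerAvg n (Χ (a k) (b k)) ((2:ℝ) ^ l) (g k) x
      - kerAvg n (Χ (a k) (b k)) (2 * (2:ℝ) ^ l) (g k) x)) S) :
    S = ∑ k, (if a k = b k then m₀ else 0) * g k x := by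
  obtain ⟨-, -, hΧ, -, hΧ3, -, hint, -⟩ := hP
  have e : ∀ l : ℤ, (2:ℝ) * 2 ^ l = 2 ^ (l + 1) := fun l => by
    rw [zpow_add_one₀ two_ne_zero, mul_comm]
  simp only [e, Finset.sum_sub_distrib] at h
  have hbot : Tendsto (fun l : ℤ => ∑ k, kerAvg n (Χ (a k) (b k)) ((2:ℝ) ^ l) (g k) x) atBot
      (𝓝 (∑ k, (if a k = b k then m₀ else 0) * g k x)) := by
    refine tendsto_finsetSum _ fun k _ => ?_
    rw [← hint]
    exact tendsto_kerAvg_atBot (hΧ _ _).continuous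
      (hasCompactSupport_of_tsupport_subset_closedBall (hΧ3 _ _)) (hg k) x
  have htop : Tendsto (fun l : ℤ => ∑ k, kerAvg n (Χ (a k) (b k)) ((2:ℝ) ^ l) (g k) x) atTop
      (𝓝 (∑ _k : Fin n, 0)) :=
    tendsto_finsetSum _ fun k _ => tendsto_kerAvg_atTop hn hν0 hν (hΧ _ _) (hΧ3 _ _) (hg k) hM
      (hgM k) x
  simpa using hasSum_int_telescope
    (G := fun l : ℤ => ∑ k, kerAvg n (Χ (a k) (b k)) ((2:ℝ) ^ l) (g k) x) h hbot htop

lemma HolderDecay.component {m : ℕ} {α ν M : ℝ} {F : Euc n → Euc n}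
    (hF : HolderDecay n m α ν M F) (k : Fin n) : HolderDecay n m α ν M fun y => F y k := by
  refine (hF.clm_comp (EuclideanSpace.proj k : Euc n →L[ℝ] ℝ)).mono ?_
  have h : ‖(EuclideanSpace.proj k : Euc n →L[ℝ] ℝ)‖ ≤ 1 :=
    ContinuousLinearMap.opNorm_le_bound _ zero_le_one fun y => by
      simpa using PiLp.norm_apply_le y k
  nlinarith [hF.nonneg]

lemma HolderDecay.norm_le {E : Type*} [NormedAddCommGroup E] [NormedSpace ℝ E] {m : ℕ}
    {α ν M : ℝ} {f : Euc n → E} (hf : HolderDecay n m α ν M f) (y : Euc n) :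
    ‖f y‖ ≤ M * (1 + ‖y‖) ^ (-ν) := by
  simpa using hf.2.1 0 (Nat.zero_le _) y

lemma IsVectorProfile.exists_holderDecay_vecPot (hP : IsVectorProfile n m₀ Ψ Χ) (hn : 1 ≤ n)
    {ν α : ℝ} (hν0 : 2 < ν) (hν : ν < n) (hα : 0 < α) (hα1 : α < 1) (m : ℕ) :
    ∃ K : ℝ, 0 ≤ K ∧ ∀ F M, HolderDecay n m α ν M F →
      HolderDecay n (m + 2) α (ν - 2) (K * M) (vecPot n m₀ Ψ F) := by
  have hex := fun j k => exists_holderDecay_dyadSum (E := ℝ) hn hν0 hν hα hα1 (hP.2.1 j k)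
    three_pos (hP.2.2.2.1 j k) m
  choose K hK h using hex
  let T : Fin n → ℝ →L[ℝ] Euc n := fun j =>
    (m₀⁻¹ • ContinuousLinearMap.id ℝ ℝ).smulRight (EuclideanSpace.single j (1:ℝ))
  refine ⟨∑ j, ‖T j‖ * ∑ k, K j k, Finset.sum_nonneg fun j _ =>
    mul_nonneg (norm_nonneg _) (Finset.sum_nonneg fun k _ => hK j k), fun F M hF => ?_⟩
  have h1 := HolderDecay.sum Finset.univ fun j =>
    (HolderDecay.sum Finset.univ fun k => h j k _ M (hF.component k)).clm_comp (T j)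
  convert h1 using 1
  · simp only [Finset.sum_mul, mul_assoc]
  · rfl

/-- The vector potential solves the equation. -/
lemma IsVectorProfile.vLap_vecPot (hP : IsVectorProfile n m₀ Ψ Χ) (hn : 1 ≤ n)
    {ν α : ℝ} (hν0 : 2 < ν) (hν : ν < n) (hα : 0 < α) {m : ℕ} {M : ℝ} {F : Euc n → Euc n}
    (hF : HolderDecay n m α ν M F) (x : Euc n) (j : Fin n) :
    vLap n (vecPot n m₀ Ψ F) x j = F x j := by
  set D : Fin n → Fin n → Euc n → ℝ := fun a k => dyadSum n (Ψ a k) fun y => F y k with hD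
  have hD2 : ∀ a k, ContDiff ℝ 2 (D a k) := fun a k =>
    (contDiff_dyadSum hn hν0 hν hα (hP.2.1 a k) three_pos (hP.2.2.2.1 a k)
      (hF.component k)).1.of_le (by exact_mod_cast (by omega : 2 ≤ m + 2))
  have hX : ∀ a, (fun y => vecPot n m₀ Ψ F y a) = fun y => m₀⁻¹ * ∑ k, D a k y :=
    fun a => funext fun y => vecPot_apply m₀ Ψ F y a
  have hpp : ∀ a b c, pder n (pder n (fun y => vecPot n m₀ Ψ F y a) b) c x
      = m₀⁻¹ * ∑ k, pder n (pder n (D a k) b) c x := by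
    intro a b c
    have d1 : ∀ k, Differentiable ℝ (D a k) := fun k => (hD2 a k).differentiable two_ne_zero
    have d2 : ∀ k, Differentiable ℝ (pder n (D a k) b) := fun k => differentiable_pder (hD2 a k) b
    rw [hX, pder_const_mul (Differentiable.fun_sum fun k _ => d1 k), pder_sum _ d1,
      pder_const_mul (Differentiable.fun_sum fun k _ => d2 k), pder_sum _ d2]
  have hX2 : ∀ a, ContDiff ℝ 2 fun y => vecPot n m₀ Ψ F y a := fun a => by
    rw [hX]
    exact contDiff_const.mul (ContDiff.sum fun k _ => hD2 a k)
  have hs : ∀ a k b c, HasSum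
      (fun l : ℤ => kerAvg n (pder n (pder n (Ψ a k) b) c) ((2:ℝ) ^ l) (fun y => F y k) x)
      (pder n (pder n (D a k) b) c x) := fun a k b c =>
    hasSum_pder_pder_dyadSum hn hν0 hν hα (hP.2.1 a k) three_pos (hP.2.2.2.1 a k)
      (hF.component k) b c x
  have hsum : HasSum (fun l : ℤ => ∑ k, (kerAvg n (Χ j k) ((2:ℝ) ^ l) (fun y => F y k) x
      - kerAvg n (Χ j k) (2 * (2:ℝ) ^ l) (fun y => F y k) x))
      (∑ k, (-(1 / 2) * ∑ i, pder n (pder n (D j k) i) i x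
        - ((n:ℝ) - 2) / (2 * n) * ∑ i, pder n (pder n (D i k) i) j x)) := by
    refine hasSum_sum fun k _ => ?_
    simp only [← hP.kerAvg_eq (hF.component k).1.continuous]
    exact ((hasSum_sum fun i _ => hs j k i i).mul_left _).sub
      ((hasSum_sum fun i _ => hs i k i j).mul_left _)
  have hval := hP.eq_of_hasSum hn (by linarith) hν (fun k => (hF.component k).1.continuous)
    hF.nonneg (fun k y => (hF.component k).norm_le y) x (fun _ => j) (fun k => k) hsum
  simp only [ite_mul, zero_mul, Finset.sum_ite_eq, Finset.mem_univ, if_true] at hval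
  rw [vLap_eq (by omega) hX2]
  simp only [hpp]
  have hm : m₀ ≠ 0 := hP.1
  rw [← mul_right_inj' hm, ← hval, Finset.sum_sub_distrib]
  simp only [← Finset.mul_sum]
  rw [Finset.sum_comm (f := fun k i => pder n (pder n (D j k) i) i x),
    Finset.sum_comm (f := fun k i => pder n (pder n (D i k) i) j x)]
  field_simp

/-- Decaying solutions are given by the vector potential. -/
lemma IsVectorProfile.eq_vecPot (hP : IsVectorProfile n m₀ Ψ Χ) (hn : 1 ≤ n)
    {μ α : ℝ} (hμ0 : 0 < μ) (hμ : μ + 2 < n) (hα : 0 < α) {m m' : ℕ} {M M' : ℝ}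
    {F X : Euc n → Euc n} (hF : HolderDecay n m α (μ + 2) M F)
    (hX : HolderDecay n (m' + 2) α μ M' X) (hXF : ∀ x j, vLap n X x j = F x j) :
    X = vecPot n m₀ Ψ F := by
  have hm : m₀ ≠ 0 := hP.1
  have hX2 : ∀ k, ContDiff ℝ 2 fun y => X y k := fun k =>
    (hX.component k).1.of_le (by exact_mod_cast (by omega : 2 ≤ m' + 2))
  have hXc : ∀ a b c, Continuous (pder n (pder n (fun y => X y a) b) c) := fun a b c => by
    have := (contDiff_one_pder (hX2 a) b).continuous_fderiv one_ne_zero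
    exact this.clm_apply continuous_const
  have hc := fun a b => hasCompactSupport_of_tsupport_subset_closedBall (hP.2.2.2.1 a b)
  have hFk : ∀ k, (fun y => F y k) = fun y =>
      -(1 / 2) * ∑ i, pder n (pder n (fun y => X y k) i) i y
        - ((n:ℝ) - 2) / (2 * n) * ∑ i, pder n (pder n (fun y => X y i) i) k y :=
    fun k => funext fun y => by rw [← hXF, vLap_eq (by omega) hX2]
  ext x j
  have hscale : ∀ l : ℤ, ∑ k, dyadTerm n (Ψ j k) (fun y => F y k) l x
      = ∑ k, (kerAvg n (Χ k j) ((2:ℝ) ^ l) (fun y => X y k) x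
        - kerAvg n (Χ k j) (2 * (2:ℝ) ^ l) (fun y => X y k) x) := by
    intro l
    have hs : (0:ℝ) < 2 ^ l := by positivity
    simp only [← hP.kerAvg_eq (hX2 _).continuous]
    have hterm : ∀ k, dyadTerm n (Ψ j k) (fun y => F y k) l x
        = -(1 / 2) * ∑ i, kerAvg n (pder n (pder n (Ψ j k) i) i) ((2:ℝ) ^ l) (fun y => X y k) x
          - ((n:ℝ) - 2) / (2 * n)
            * ∑ i, kerAvg n (pder n (pder n (Ψ j k) k) i) ((2:ℝ) ^ l) (fun y => X y i) x := by
      intro k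
      rw [dyadTerm, hFk, kerAvg_combination_right (hP.2.1 j k).continuous (hc j k)
        (fun i => hXc k i i) fun i => hXc i i k]
      simp only [← kerAvg_pder_pder (hP.2.1 j k) (hc j k) (hX2 _) hs, ← Finset.mul_sum,
        smul_eq_mul]
      ring
    simp only [hterm, Finset.sum_sub_distrib, ← Finset.mul_sum]
    rw [Finset.sum_comm (f := fun k i =>
      kerAvg n (pder n (pder n (Ψ j k) k) i) ((2:ℝ) ^ l) (fun y => X y i) x)]
    simp only [hP.2.2.2.2.2.1 j]
  have hsum : HasSum (fun l : ℤ => ∑ k, dyadTerm n (Ψ j k) (fun y => F y k) l x)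
      (∑ k, dyadSum n (Ψ j k) (fun y => F y k) x) :=
    hasSum_sum fun k _ => hasSum_dyadSum hn (by linarith) hμ hα (hP.2.1 j k) three_pos
      (hP.2.2.2.1 j k) (hF.component k) x
  simp only [hscale] at hsum
  have hval := hP.eq_of_hasSum hn hμ0 (by linarith) (fun k => (hX2 k).continuous) hX.nonneg
    (fun k y => (hX.component k).norm_le y) x (fun k => k) (fun _ => j) hsum
  simp only [ite_mul, zero_mul, Finset.sum_ite_eq', Finset.mem_univ, if_true] at hval
  rw [vecPot_apply, hval, inv_mul_cancel_left₀ hm]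

end VectorPotential

/-- For `n ≥ 3`, `k ≥ 1`, `α ∈ (0,1)`, `0 < μ < n−2`, the flat vector
Laplacian `L = −div∘𝒟 : C^{k+1,α}_{−μ}(ℝⁿ,ℝⁿ) → C^{k−1,α}_{−μ−2}(ℝⁿ,ℝⁿ)` is an
isomorphism: every `F` in the target has a unique preimage `X`, with a uniform bound
`‖X‖_{k+1,α,−μ} ≤ C ‖F‖_{k−1,α,−μ−2}`. -/
theorem vector_laplacian_isomorphism_weighted_Holder
    (n k : ℕ) (α μ : ℝ) (hn : 3 ≤ n) (hk : 1 ≤ k)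
    (hα0 : 0 < α) (hα1 : α < 1) (hμ0 : 0 < μ) (hμ1 : μ < (n:ℝ) - 2) :
    (∀ F : Euc n → Euc n, MemW n (k-1) α (μ+2) F →
      ∃! X : Euc n → Euc n, MemW n (k+1) α μ X ∧
        ∀ (x : Euc n) (j : Fin n), vLap n X x j = F x j) ∧
    ∃ C : ℝ, 0 < C ∧ ∀ (F X : Euc n → Euc n),
      MemW n (k+1) α μ X → (∀ (x : Euc n) (j : Fin n), vLap n X x j = F x j) →
      ∀ CF : ℝ, WBound n (k-1) α (μ+2) CF F → WBound n (k+1) α μ (C * CF) X := by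
  obtain ⟨m, rfl⟩ : ∃ m, k = m + 1 := ⟨k - 1, by omega⟩
  rw [Nat.add_sub_cancel, show m + 1 + 1 = m + 2 from rfl]
  have hn1 : 1 ≤ n := by omega
  have hν : μ + 2 < n := by linarith
  obtain ⟨m₀, Ψ, Χ, hP⟩  := exists_vector_profile hn
  obtain ⟨K, hK, hpot⟩ :=
    hP.exists_holderDecay_vecPot hn1 (by linarith : 2 < μ + 2) hν hα0 hα1 m
  rw [add_sub_cancel_right] at hpot
  have hdecay : ∀ {F : Euc n → Euc n} {C : ℝ}, WBound n m α (μ + 2) C F →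
      HolderDecay n m α (μ + 2) (2 * 4 ^ (μ + 2 + m + α) * C) F :=
    fun hF => hF.holderDecay hα0 (by linarith)
  have hbound : ∀ {F : Euc n → Euc n} {C : ℝ}, WBound n m α (μ + 2) C F →
      WBound n (m + 2) α μ (2 * 4 ^ α * ((K + 1) * (2 * 4 ^ (μ + 2 + m + α) * C)))
        (vecPot n m₀ Ψ F) := by
    intro F C hF
    refine HolderDecay.wBound hα0 hμ0.le ((hpot F _ (hdecay hF)).mono ?_)
    have := (hdecay hF).nonneg
    gcongr
    linarith
  have huniq : ∀ {F X : Euc n → Euc n}, MemW n m α (μ + 2) F → MemW n (m + 2) α μ X →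
      (∀ x j, vLap n X x j = F x j) → X = vecPot n m₀ Ψ F := by
    rintro F X ⟨C, hF⟩ ⟨C', hX⟩ h
    exact hP.eq_vecPot hn1 hμ0 hν hα0 (hdecay hF) (hX.holderDecay hα0 hμ0.le) h
  refine ⟨fun F hF => ?_, 2 * 4 ^ α * ((K + 1) * (2 * 4 ^ (μ + 2 + m + α))), by positivity,
    fun F X hX h CF hF => ?_⟩
  · obtain ⟨C, hC⟩ := hF
    exact ⟨vecPot n m₀ Ψ F, ⟨⟨_, hbound hC⟩,
      hP.vLap_vecPot hn1 (by linarith) hν hα0 (hdecay hC)⟩,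
      fun X hX => huniq ⟨C, hC⟩ hX.1 hX.2⟩
  · rw [huniq ⟨CF, hF⟩ hX h]
    convert hbound hF using 1
    ring
end
end

section
/- Let n ≥ 3, ρ > 0, and let u be harmonic on the exterior region {x ∈ ℝⁿ : |x| > ρ} with u(x) → 1 as |x| → ∞. Then there exist a real number E (the total energy) and a constant C > 0 such that |u(x) − 1 − E|x|^{2−n}| ≤ C|x|^{1−n} for all x with |x| ≥ 2ρ; that is, u(x) = 1 + E|x|^{2−n} + O(|x|^{1−n}) as |x| → ∞. -/
noncomputable section

open scoped BigOperators
open Filter MeasureTheory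

/-- `u` is harmonic on `U`: `C²` on `U` and `Δu = 0` on `U`. -/
def HarmonicOnSet (n : ℕ) (u : Euc n → ℝ) (U : Set (Euc n)) : Prop :=
  ContDiffOn ℝ 2 u U ∧ ∀ x ∈ U, lap n u x = 0

open Topology InnerProductSpace Laplacian

theorem tendsto_norm_rpow_comap_norm_atTop {E : Type*} [NormedAddCommGroup E] {p : ℝ} (hp : p < 0) :
    Tendsto (fun x : E => ‖x‖ ^ p) (comap (fun x : E => ‖x‖) atTop) (𝓝 0) := by
  simpa [Function.comp_def] using
    (tendsto_rpow_neg_atTop (neg_pos.2 hp)).comp (tendsto_comap (f := fun x : E => ‖x‖))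

section Laplacian

variable {E : Type*} [NormedAddCommGroup E] [InnerProductSpace ℝ E]

theorem iteratedFDeriv_two_eq_deriv_deriv {f : E → ℝ} {x : E} (hf : ContDiffAt ℝ 2 f x) (v : E) :
    iteratedFDeriv ℝ 2 f x ![v, v] = deriv (deriv fun t : ℝ => f (x + t • v)) 0 := by
  have line (t : ℝ) : HasDerivAt (fun t : ℝ => x + t • v) v t := by
    simpa using ((hasDerivAt_id t).smul_const v).const_add x
  have tends : Tendsto (fun t : ℝ => x + t • v) (𝓝 0) (𝓝 x) := by
    simpa using (line 0).continuousAt.tendsto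
  have first : (deriv fun t : ℝ => f (x + t • v)) =ᶠ[𝓝 0] fun t => fderiv ℝ f (x + t • v) v := by
    filter_upwards [tends.eventually (hf.eventually (by simp))] with t ht
    exact ((ht.differentiableAt (by simp)).hasFDerivAt.comp_hasDerivAt t (line t)).deriv
  have second : HasFDerivAt (fderiv ℝ f) (fderiv ℝ (fderiv ℝ f) x) (x + (0 : ℝ) • v) := by
    rw [zero_smul, add_zero]
    exact ((hf.fderiv_right (m := 1) (by norm_num)).differentiableAt (by simp)).hasFDerivAt
  have second_line : HasDerivAt (fun t : ℝ => fderiv ℝ f (x + t • v))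
      (fderiv ℝ (fderiv ℝ f) x v) 0 := second.comp_hasDerivAt (0 : ℝ) (line 0)
  rw [first.deriv_eq, iteratedFDeriv_two_apply]
  exact ((ContinuousLinearMap.apply ℝ ℝ v).hasFDerivAt.comp_hasDerivAt
    (0 : ℝ) second_line).deriv.symm

theorem IsLocalMax.deriv_deriv_nonpos {g : ℝ → ℝ} {a : ℝ} (h : IsLocalMax g a)
    (hg : ContinuousAt g a) : deriv (deriv g) a ≤ 0 := by
  by_contra! hpos
  have hmin := isLocalMin_of_deriv_deriv_pos hpos h.deriv_eq_zero hg
  have hconst : g =ᶠ[𝓝 a] fun _ => g a := by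
    filter_upwards [h, hmin] with t h₁ h₂ using le_antisymm h₁ h₂
  have := hconst.deriv.deriv_eq
  simp [this] at hpos

theorem IsLocalMax.laplacian_nonpos [FiniteDimensional ℝ E] {f : E → ℝ} {x : E}
    (h : IsLocalMax f x) (hf : ContDiffAt ℝ 2 f x) : Δ f x ≤ 0 := by
  rw [laplacian_eq_iteratedFDeriv_stdOrthonormalBasis]
  refine Finset.sum_nonpos fun i _ => ?_
  rw [iteratedFDeriv_two_eq_deriv_deriv hf]
  set v := stdOrthonormalBasis ℝ E i
  have cont : ContinuousAt (fun t : ℝ => x + t • v) 0 := by fun_prop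
  refine IsLocalMax.deriv_deriv_nonpos ?_ ?_
  · have : Tendsto (fun t : ℝ => x + t • v) (𝓝 0) (𝓝 x) := by simpa using cont.tendsto
    simpa [IsLocalMax, IsMaxFilter] using this.eventually h
  · exact ContinuousAt.comp (by simpa using hf.continuousAt) cont

theorem laplacian_norm_sq [FiniteDimensional ℝ E] (x : E) :
    Δ (fun y : E => ‖y‖ ^ 2) x = 2 * Module.finrank ℝ E := by
  have hd (v : E) (hv : ‖v‖ = 1) : iteratedFDeriv ℝ 2 (fun y : E => ‖y‖ ^ 2) x ![v, v] = 2 := by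
    rw [iteratedFDeriv_two_eq_deriv_deriv (contDiff_norm_sq ℝ).contDiffAt]
    have h₁ : (deriv fun t : ℝ => ‖x + t • v‖ ^ 2) = fun t => 2 * inner ℝ x v + 2 * t := by
      funext t
      have : (fun t : ℝ => ‖x + t • v‖ ^ 2) = fun t => ‖x‖ ^ 2 + t * (2 * inner ℝ x v) + t ^ 2 := by
        funext t
        rw [norm_add_sq_real, norm_smul, hv, inner_smul_right, mul_one, Real.norm_eq_abs, sq_abs]
        ring
      rw [this]
      simp
    rw [h₁]
    simp
  rw [laplacian_eq_iteratedFDeriv_stdOrthonormalBasis]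
  simp [hd, mul_comm]

/-- A maximum principle on possibly unbounded closed sets. -/
theorem nonpos_of_harmonicAt_of_boundary_nonpos [FiniteDimensional ℝ E] [Nontrivial E]
    {K : Set E} (hK : IsClosed K) {w : E → ℝ} (hw : ContinuousOn w K)
    (hharm : ∀ x ∈ K, w x ≤ 0 ∨ K ∈ 𝓝 x ∧ HarmonicAt w x)
    (hlim : Tendsto w (comap (fun x : E => ‖x‖) atTop) (𝓝 0)) : ∀ x ∈ K, w x ≤ 0 := by
  intro x₀ hx₀
  by_contra! hpos
  obtain ⟨R₀, -, hR₀⟩ := (atTop_basis.comap fun x : E => ‖x‖).eventually_iff.1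
    (hlim.eventually_lt_const (half_pos hpos))
  set R := max R₀ (max 1 ‖x₀‖)
  have hR : 0 < R := lt_max_of_lt_right (lt_max_of_lt_left one_pos)
  set ε := w x₀ / 2 / R ^ 2
  have hε : 0 < ε := by positivity
  have hεR : ε * R ^ 2 = w x₀ / 2 := by simp only [ε]; field_simp
  have hcont : ContinuousOn (fun x => w x + ε * ‖x‖ ^ 2) K := by fun_prop
  obtain ⟨y, ⟨hyK, hyR⟩, hy⟩ := ((isCompact_closedBall (0 : E) R).inter_left hK).exists_isMaxOn
    ⟨x₀, hx₀, by simp [R]⟩ (hcont.mono Set.inter_subset_left)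
  have hyR : ‖y‖ ≤ R := by simpa using hyR
  have hyx : w x₀ + ε * ‖x₀‖ ^ 2 ≤ w y + ε * ‖y‖ ^ 2 := hy ⟨hx₀, by simp [R]⟩
  have hy₂ : ε * ‖y‖ ^ 2 ≤ w x₀ / 2 := by rw [← hεR]; gcongr
  have hx₂ : 0 ≤ ε * ‖x₀‖ ^ 2 := by positivity
  have hyR' : ‖y‖ < R := by
    by_contra! hle
    linarith [hR₀ (Set.mem_preimage.2 <| Set.mem_Ici.2 <| (le_max_left _ _).trans hle)]
  obtain h | ⟨hnhds, hyh⟩ := hharm y hyK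
  · linarith
  have hmax : IsLocalMax (fun x => w x + ε * ‖x‖ ^ 2) y := by
    filter_upwards [hnhds, Metric.isOpen_ball.mem_nhds (by simpa using hyR' : y ∈ Metric.ball 0 R)]
      with z hz hz'
    exact hy ⟨hz, Metric.ball_subset_closedBall hz'⟩
  have hsq : ContDiffAt ℝ 2 (fun x : E => ‖x‖ ^ 2) y := (contDiff_norm_sq ℝ).contDiffAt
  have hlap : Δ (w + ε • fun x : E => ‖x‖ ^ 2) y = _ :=
    hyh.1.laplacian_add (hsq.const_smul ε)
  rw [laplacian_smul ε hsq, laplacian_norm_sq, hyh.2.eq_of_nhds] at hlap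
  have hnonpos := hmax.laplacian_nonpos (hyh.1.add (hsq.const_smul ε))
  have hdim : 0 < (Module.finrank ℝ E : ℝ) := by exact_mod_cast Module.finrank_pos
  have : 0 < ε * (2 * Module.finrank ℝ E) := by positivity
  have hlap' : Δ (fun x => w x + ε * ‖x‖ ^ 2) y = ε * (2 * Module.finrank ℝ E) := by
    simpa using! hlap
  linarith

theorem laplacian_comp_linearIsometryEquiv [FiniteDimensional ℝ E] (σ : E ≃ₗᵢ[ℝ] E) {f : E → ℝ}
    {x : E} (hf : ContDiffAt ℝ 2 f (σ x)) : Δ (f ∘ σ) x = Δ f (σ x) := by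
  have hσ : ContDiffAt ℝ 2 (f ∘ σ) x := hf.comp x σ.contDiff.contDiffAt
  rw [laplacian_eq_iteratedFDeriv_stdOrthonormalBasis,
    laplacian_eq_iteratedFDeriv_orthonormalBasis f ((stdOrthonormalBasis ℝ E).map σ)]
  refine Finset.sum_congr rfl fun i _ => ?_
  rw [iteratedFDeriv_two_eq_deriv_deriv hσ, OrthonormalBasis.map_apply,
    iteratedFDeriv_two_eq_deriv_deriv hf]
  simp

theorem InnerProductSpace.HarmonicAt.comp_linearIsometryEquiv [FiniteDimensional ℝ E]
    (σ : E ≃ₗᵢ[ℝ] E) {f : E → ℝ} {x : E} (hf : HarmonicAt f (σ x)) : HarmonicAt (f ∘ σ) x := by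
  refine ⟨hf.1.comp x σ.contDiff.contDiffAt, ?_⟩
  filter_upwards [σ.continuous.continuousAt.eventually (hf.eventually)] with y hy
  rw [laplacian_comp_linearIsometryEquiv σ hy.1, hy.2.eq_of_nhds]
  rfl

theorem laplacian_affine_mul_norm_sq_rpow [FiniteDimensional ℝ E] (κ s : ℝ) (e : E) {x : E}
    (hx : x ≠ 0) :
    Δ (fun y : E => (κ + inner ℝ e y) * (‖y‖ ^ 2) ^ s) x =
      2 * s * (κ * (Module.finrank ℝ E + 2 * s - 2) +
        inner ℝ e x * (Module.finrank ℝ E + 2 * s)) * (‖x‖ ^ 2) ^ (s - 1) := by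
  have hQ : 0 < ‖x‖ ^ 2 := by positivity
  have hsmooth : ContDiffAt ℝ 2 (fun y : E => (κ + inner ℝ e y) * (‖y‖ ^ 2) ^ s) x :=
    (contDiffAt_const.add (contDiffAt_const.inner ℝ contDiffAt_id)).mul
      ((contDiff_norm_sq ℝ).contDiffAt.rpow_const_of_ne hQ.ne')
  have hd (v : E) (hv : ‖v‖ = 1) :
      iteratedFDeriv ℝ 2 (fun y : E => (κ + inner ℝ e y) * (‖y‖ ^ 2) ^ s) x ![v, v] =
        4 * s * (‖x‖ ^ 2) ^ (s - 1) * (inner ℝ e v * inner ℝ v x) +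
        4 * s * (s - 1) * (κ + inner ℝ e x) * (‖x‖ ^ 2) ^ (s - 2) * inner ℝ x v ^ 2 +
        2 * s * (κ + inner ℝ e x) * (‖x‖ ^ 2) ^ (s - 1) := by
    rw [iteratedFDeriv_two_eq_deriv_deriv hsmooth, real_inner_comm x v]
    set a := κ + inner ℝ e x
    set b : ℝ := inner ℝ e v
    set c : ℝ := inner ℝ x v
    set Q := ‖x‖ ^ 2
    have hline : (fun t : ℝ => (κ + inner ℝ e (x + t • v)) * (‖x + t • v‖ ^ 2) ^ s) =
        fun t => (a + t * b) * (Q + t * (2 * c) + t ^ 2) ^ s := by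
      funext t
      rw [norm_add_sq_real, norm_smul, hv, inner_smul_right, mul_one, Real.norm_eq_abs, sq_abs,
        inner_add_right, inner_smul_right]
      simp only [a, b, c, Q]
      ring_nf
    have hP (t : ℝ) : HasDerivAt (fun t : ℝ => Q + t * (2 * c) + t ^ 2) (2 * c + 2 * t) t := by
      simpa using (((hasDerivAt_id t).mul_const (2 * c)).const_add Q).fun_add
        ((hasDerivAt_id t).fun_pow 2)
    have hA (t : ℝ) : HasDerivAt (fun t : ℝ => a + t * b) b t := by
      simpa using ((hasDerivAt_id t).mul_const b).const_add a
    have hne : ∀ᶠ t in 𝓝 (0 : ℝ), Q + t * (2 * c) + t ^ 2 ≠ 0 :=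
      (hP 0).continuousAt.eventually_ne (by simpa using hQ.ne')
    have hfirst : (deriv fun t : ℝ => (a + t * b) * (Q + t * (2 * c) + t ^ 2) ^ s) =ᶠ[𝓝 0]
        fun t => b * (Q + t * (2 * c) + t ^ 2) ^ s +
          (a + t * b) * ((2 * c + 2 * t) * s * (Q + t * (2 * c) + t ^ 2) ^ (s - 1)) := by
      filter_upwards [hne] with t ht
      exact ((hA t).fun_mul ((hP t).rpow_const (Or.inl ht))).deriv
    have hL : HasDerivAt (fun t : ℝ => (2 * c + 2 * t) * s) (2 * s) 0 := by
      simpa using (((hasDerivAt_id (0 : ℝ)).const_mul 2).const_add (2 * c)).mul_const s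
    have hsecond := (((hP 0).rpow_const (p := s) (Or.inl hne.self_of_nhds)).const_mul b).fun_add
      ((hA 0).fun_mul (hL.fun_mul ((hP 0).rpow_const (p := s - 1) (Or.inl hne.self_of_nhds))))
    rw [hline, hfirst.deriv_eq, hsecond.deriv]
    norm_num [show s - 1 - 1 = s - 2 by ring]
    ring
  have hpow : (‖x‖ ^ 2) ^ (s - 2) * ‖x‖ ^ 2 = (‖x‖ ^ 2) ^ (s - 1) := by
    rw [← Real.rpow_add_one hQ.ne']; congr 1; ring
  rw [laplacian_eq_iteratedFDeriv_stdOrthonormalBasis]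
  have hsum := (stdOrthonormalBasis ℝ E).sum_inner_mul_inner e x
  have hsq : ∑ i, inner ℝ x (stdOrthonormalBasis ℝ E i) ^ 2 = ‖x‖ ^ 2 := by
    simpa using (stdOrthonormalBasis ℝ E).sum_sq_norm_inner_left x
  simp only [hd _ ((stdOrthonormalBasis ℝ E).norm_eq_one _), Finset.sum_add_distrib,
    ← Finset.mul_sum, hsum, hsq, Finset.sum_const, Finset.card_univ, Fintype.card_fin,
    nsmul_eq_mul]
  rw [mul_assoc _ ((‖x‖ ^ 2) ^ (s - 2)), hpow]
  ring

theorem harmonicAt_affine_mul_norm_sq_rpow [FiniteDimensional ℝ E] (κ s : ℝ) (e : E)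
    (hκ : κ * (Module.finrank ℝ E + 2 * s - 2) = 0)
    (he : e = 0 ∨ Module.finrank ℝ E + 2 * s = 0) {x : E} (hx : x ≠ 0) :
    HarmonicAt (fun y : E => (κ + inner ℝ e y) * (‖y‖ ^ 2) ^ s) x := by
  refine ⟨(contDiffAt_const.add (contDiffAt_const.inner ℝ contDiffAt_id)).mul
      ((contDiff_norm_sq ℝ).contDiffAt.rpow_const_of_ne (by positivity)), ?_⟩
  filter_upwards [isOpen_ne.mem_nhds hx] with y hy
  rw [laplacian_affine_mul_norm_sq_rpow κ s e hy, hκ]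
  obtain rfl | h := he
  · simp
  · simp [h]

theorem harmonicAt_norm_rpow [FiniteDimensional ℝ E] {x : E} (hx : x ≠ 0) :
    HarmonicAt (fun y : E => ‖y‖ ^ ((2 : ℝ) - Module.finrank ℝ E)) x := by
  convert harmonicAt_affine_mul_norm_sq_rpow 1 (((2 : ℝ) - Module.finrank ℝ E) / 2) (0 : E)
    (by ring) (Or.inl rfl) hx using 2 with y
  rw [← Real.rpow_natCast_mul (norm_nonneg y)]
  simp [mul_div_cancel₀]

theorem harmonicAt_inner_mul_norm_rpow [FiniteDimensional ℝ E] (e : E) {x : E} (hx : x ≠ 0) :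
    HarmonicAt (fun y : E => inner ℝ e y * ‖y‖ ^ (-(Module.finrank ℝ E : ℝ))) x := by
  convert harmonicAt_affine_mul_norm_sq_rpow 0 (-(Module.finrank ℝ E : ℝ) / 2) e
    (by ring) (Or.inr (by ring)) hx using 2 with y
  rw [← Real.rpow_natCast_mul (norm_nonneg y)]
  simp [mul_div_cancel₀]

theorem tendsto_inner_mul_norm_rpow_comap_norm_atTop (e : E) {p : ℝ} (hp : p < -1) :
    Tendsto (fun x : E => inner ℝ e x * ‖x‖ ^ p) (comap (fun x : E => ‖x‖) atTop) (𝓝 0) := by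
  have hbound := (tendsto_norm_rpow_comap_norm_atTop (E := E) (by linarith : p + 1 < 0)).const_mul
    ‖e‖
  rw [mul_zero] at hbound
  refine squeeze_zero_norm' ?_ hbound
  filter_upwards [tendsto_comap.eventually (eventually_gt_atTop 0)] with x hx
  rw [Real.rpow_add_one hx.ne', norm_mul, Real.norm_of_nonneg (by positivity : 0 ≤ ‖x‖ ^ p)]
  calc ‖inner ℝ e x‖ * ‖x‖ ^ p ≤ ‖e‖ * ‖x‖ * ‖x‖ ^ p := by gcongr; exact norm_inner_le_norm e x
    _ = _ := by ring

theorem le_mul_norm_rpow_of_le_on_sphere [FiniteDimensional ℝ E] (hdim : 3 ≤ Module.finrank ℝ E)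
    {v : E → ℝ} {r c : ℝ} (hr : 0 < r) (hv : ∀ x, r ≤ ‖x‖ → HarmonicAt v x)
    (hlim : Tendsto v (comap (fun x : E => ‖x‖) atTop) (𝓝 0))
    (h : ∀ x, ‖x‖ = r → v x ≤ c * r ^ ((2 : ℝ) - Module.finrank ℝ E)) {x : E} (hx : r ≤ ‖x‖) :
    v x ≤ c * ‖x‖ ^ ((2 : ℝ) - Module.finrank ℝ E) := by
  have : Nontrivial E := Module.nontrivial_of_finrank_pos (R := ℝ) (by omega)
  have hdim' : (3 : ℝ) ≤ Module.finrank ℝ E := by exact_mod_cast hdim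
  set p := (2 : ℝ) - Module.finrank ℝ E
  have hharm (y : E) (hy : r ≤ ‖y‖) : HarmonicAt (v - c • fun z : E => ‖z‖ ^ p) y :=
    (hv y hy).sub (harmonicAt_norm_rpow (norm_pos_iff.1 (hr.trans_le hy))).const_smul
  have key := nonpos_of_harmonicAt_of_boundary_nonpos (K := {y : E | r ≤ ‖y‖})
    (w := v - c • fun z : E => ‖z‖ ^ p)
    (isClosed_le continuous_const continuous_norm)
    (fun y hy => (hharm y hy).1.continuousAt.continuousWithinAt)
    (fun y hy => ?_) ?_ x hx
  · simpa using key
  · obtain heq | hlt := (show r ≤ ‖y‖ from hy).eq_or_lt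
    · left
      simpa [← heq] using h y heq.symm
    · right
      refine ⟨?_, hharm y hy⟩
      filter_upwards [(isOpen_lt continuous_const continuous_norm).mem_nhds hlt] with z hz
      exact le_of_lt hz
  · simpa using! hlim.sub ((tendsto_norm_rpow_comap_norm_atTop (by linarith : p < 0)).const_mul c)

theorem exists_lipschitzOnWith_sphere [FiniteDimensional ℝ E] {v : E → ℝ} {r : ℝ}
    (hv : ∀ x, ‖x‖ = r → ContDiffAt ℝ 1 v x) :
    ∃ L, LipschitzOnWith L v (Metric.sphere 0 r) := by
  refine LocallyLipschitzOn.exists_lipschitzOnWith_of_compact (isCompact_sphere 0 r) fun x hx => ?_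
  obtain ⟨L, t, ht, hL⟩ := (hv x (by simpa using hx)).exists_lipschitzOnWith
  exact ⟨L, t, mem_nhdsWithin_of_mem_nhds ht, hL⟩

theorem sub_reflection_orthogonal_singleton (e z : E) :
    z - (ℝ ∙ e)ᗮ.reflection z = (2 * (inner ℝ e z / ‖e‖ ^ 2)) • e := by
  rw [Submodule.reflection_orthogonal_apply, Submodule.reflection_singleton_apply, two_smul,
    two_mul, add_smul]
  simp

/-- The oscillation over spheres is controlled by comparing the odd part of a harmonic function
under a reflection with the dipole `⟪e, z⟫ ‖z‖⁻ⁿ` on a half-space. -/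
theorem sub_le_of_norm_eq [FiniteDimensional ℝ E] (hdim : 3 ≤ Module.finrank ℝ E)
    {v : E → ℝ} {r : ℝ} (hr : 0 < r) (hv : ∀ x, r ≤ ‖x‖ → HarmonicAt v x)
    (hlim : Tendsto v (comap (fun x : E => ‖x‖) atTop) (𝓝 0)) {L : NNReal}
    (hL : LipschitzOnWith L v (Metric.sphere 0 r)) {x y : E} (hx : r ≤ ‖x‖) (hxy : ‖x‖ = ‖y‖) :
    v x - v y ≤ 2 * L * r ^ (Module.finrank ℝ E : ℝ) * ‖x‖ ^ ((1 : ℝ) - Module.finrank ℝ E) := by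
  have : Nontrivial E := Module.nontrivial_of_finrank_pos (R := ℝ) (by omega)
  have hdim' : (3 : ℝ) ≤ Module.finrank ℝ E := by exact_mod_cast hdim
  set N : ℝ := (Module.finrank ℝ E : ℝ)
  obtain rfl | hne := eq_or_ne x y
  · rw [sub_self]; positivity
  set e := x - y with he
  have he0 : 0 < ‖e‖ := norm_pos_iff.2 (sub_ne_zero.2 hne)
  set σ := (ℝ ∙ e)ᗮ.reflection with hσ
  have hσx : σ x = y := Submodule.reflection_sub hxy
  set D := 2 * L * r ^ N / ‖e‖ with hD
  set w : E → ℝ := v - v ∘ σ - D • fun z : E => inner ℝ e z * ‖z‖ ^ (-N) with hw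
  have hharm (z : E) (hz : r ≤ ‖z‖) : HarmonicAt w z :=
    ((hv z hz).sub ((hv (σ z) (by simpa using hz)).comp_linearIsometryEquiv σ)).sub
      (harmonicAt_inner_mul_norm_rpow e (norm_pos_iff.1 (hr.trans_le hz))).const_smul
  have hlimσ : Tendsto (v ∘ σ) (comap (fun x : E => ‖x‖) atTop) (𝓝 0) := by
    refine hlim.comp (tendsto_comap_iff.2 ?_)
    simpa only [Function.comp_def, LinearIsometryEquiv.norm_map] using tendsto_comap
  have hlimw : Tendsto w (comap (fun x : E => ‖x‖) atTop) (𝓝 0) := by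
    simpa using! (hlim.sub hlimσ).sub
      ((tendsto_inner_mul_norm_rpow_comap_norm_atTop e (by linarith : -N < -1)).const_mul D)
  have hboundary (z : E) (hz : r ≤ ‖z‖) (hez : 0 ≤ inner ℝ e z)
      (hzb : ‖z‖ = r ∨ inner ℝ e z = 0) : w z ≤ 0 := by
    have hdist : ‖z - σ z‖ = 2 * inner ℝ e z / ‖e‖ := by
      rw [hσ, sub_reflection_orthogonal_singleton, norm_smul, Real.norm_of_nonneg (by positivity)]
      field_simp
    obtain hzr | hez0 := hzb
    · have hlip := hL.norm_sub_le (x := z) (y := σ z) (by simpa using hzr) (by simpa using hzr)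
      rw [hdist] at hlip
      have hDz : D * (inner ℝ e z * ‖z‖ ^ (-N)) = L * (2 * inner ℝ e z / ‖e‖) := by
        rw [hzr, Real.rpow_neg hr.le, hD]
        field_simp
      have := (le_abs_self _).trans hlip
      simp only [hw, Pi.sub_apply, Pi.smul_apply, Function.comp_apply, smul_eq_mul, hDz]
      linarith
    · have hfix : σ z = z := by
        rw [hez0, mul_zero, zero_div, norm_eq_zero, sub_eq_zero] at hdist
        exact hdist.symm
      simp [hw, hfix, hez0]
  have hxmem : 0 ≤ inner ℝ e x := by
    rw [he, inner_sub_left, real_inner_self_eq_norm_sq, sq, sub_nonneg]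
    calc inner ℝ y x ≤ ‖y‖ * ‖x‖ := real_inner_le_norm y x
      _ = ‖x‖ * ‖x‖ := by rw [hxy]
  have key := nonpos_of_harmonicAt_of_boundary_nonpos (K := {z : E | r ≤ ‖z‖ ∧ 0 ≤ inner ℝ e z})
    (w := w)
    ((isClosed_le continuous_const continuous_norm).inter
      (isClosed_le (f := fun _ => (0 : ℝ)) (g := fun z : E => inner ℝ e z) (by fun_prop)
        (by fun_prop)))
    (fun z hz => (hharm z hz.1).1.continuousAt.continuousWithinAt)
    (fun z hz => ?_) hlimw x ⟨hx, hxmem⟩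
  · have hvx : v x - v y ≤ D * (inner ℝ e x * ‖x‖ ^ (-N)) := by
      simpa [hw, hσx, sub_nonpos] using key
    have hx0 : 0 < ‖x‖ := hr.trans_le hx
    calc v x - v y ≤ D * (inner ℝ e x * ‖x‖ ^ (-N)) := hvx
      _ ≤ D * (‖e‖ * ‖x‖ * ‖x‖ ^ (-N)) := by gcongr; exact real_inner_le_norm e x
      _ = 2 * L * r ^ N * (‖x‖ ^ (-N) * ‖x‖) := by rw [hD]; field_simp
      _ = 2 * L * r ^ N * ‖x‖ ^ (1 - N) := by
        rw [← Real.rpow_add_one hx0.ne', neg_add_eq_sub]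
  · by_cases hzb : ‖z‖ = r ∨ inner ℝ e z = 0
    · exact Or.inl (hboundary z hz.1 hz.2 hzb)
    · push Not at hzb
      refine Or.inr ⟨?_, hharm z hz.1⟩
      filter_upwards [(isOpen_lt continuous_const continuous_norm).mem_nhds
          (lt_of_le_of_ne hz.1 hzb.1.symm),
        (isOpen_lt continuous_const (continuous_const.inner continuous_id)).mem_nhds
          (lt_of_le_of_ne hz.2 hzb.2.symm)] with a h₁ h₂
      exact ⟨le_of_lt h₁, le_of_lt h₂⟩

theorem exists_abs_sub_mul_norm_rpow_le [FiniteDimensional ℝ E] (hdim : 3 ≤ Module.finrank ℝ E)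
    {v : E → ℝ} {r : ℝ} (hr : 0 < r) (hv : ∀ x, r ≤ ‖x‖ → HarmonicAt v x)
    (hlim : Tendsto v (comap (fun x : E => ‖x‖) atTop) (𝓝 0)) :
    ∃ A C : ℝ, 0 < C ∧ ∀ x : E, r ≤ ‖x‖ →
      |v x - A * ‖x‖ ^ ((2 : ℝ) - Module.finrank ℝ E)| ≤
        C * ‖x‖ ^ ((1 : ℝ) - Module.finrank ℝ E) := by
  have : Nontrivial E := Module.nontrivial_of_finrank_pos (R := ℝ) (by omega)
  obtain ⟨L, hL⟩ := exists_lipschitzOnWith_sphere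
    fun x hx => (hv x (le_of_eq hx.symm)).1.of_le one_le_two
  have hosc (x y : E) (hx : r ≤ ‖x‖) (hxy : ‖x‖ = ‖y‖) :=
    sub_le_of_norm_eq hdim hr hv hlim hL hx hxy
  set N : ℝ := (Module.finrank ℝ E : ℝ)
  set C := 2 * L * r ^ N
  have hC : 0 ≤ C := by positivity
  set lower : Set ℝ := {c | ∃ s, r ≤ s ∧ ∀ x : E, ‖x‖ = s → c * s ^ (2 - N) ≤ v x}
  have hle {c s : ℝ} (hs : r ≤ s) (hc : ∀ x : E, ‖x‖ = s → v x ≤ c * s ^ (2 - N)) :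
      c ∈ upperBounds lower := by
    rintro c' ⟨s', hs', hc'⟩
    obtain ⟨z, hz⟩ := exists_norm_eq E (hr.le.trans (hs.trans (le_max_left s s')))
    have hup := le_mul_norm_rpow_of_le_on_sphere hdim (hr.trans_le hs)
      (fun x hx => hv x (hs.trans hx)) hlim hc (x := z) (hz ▸ le_max_left s s')
    have hlow := le_mul_norm_rpow_of_le_on_sphere hdim (v := -v) (c := -c') (hr.trans_le hs')
      (fun x hx => (hv x (hs'.trans hx)).neg) (by simpa using! hlim.neg)
      (fun x hx => by simpa using hc' x hx) (x := z) (hz ▸ le_max_right s s')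
    rw [Pi.neg_apply, neg_mul, neg_le_neg_iff] at hlow
    have hz0 : 0 < ‖z‖ := hz ▸ hr.trans_le (hs.trans (le_max_left s s'))
    exact le_of_mul_le_mul_right (hlow.trans hup) (by positivity)
  have hupper {x : E} (hx : r ≤ ‖x‖) :
      (v x + C * ‖x‖ ^ (1 - N)) / ‖x‖ ^ (2 - N) ∈ upperBounds lower := by
    have hx0 : 0 < ‖x‖ ^ (2 - N) := Real.rpow_pos_of_pos (hr.trans_le hx) _
    refine hle hx fun y hy => ?_
    rw [div_mul_cancel₀ _ hx0.ne']
    have := hosc y x (hy ▸ hx) hy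
    rw [hy] at this
    linarith
  have hlower {x : E} (hx : r ≤ ‖x‖) :
      (v x - C * ‖x‖ ^ (1 - N)) / ‖x‖ ^ (2 - N) ∈ lower := by
    have hx0 : 0 < ‖x‖ ^ (2 - N) := Real.rpow_pos_of_pos (hr.trans_le hx) _
    refine ⟨‖x‖, hx, fun y hy => ?_⟩
    rw [div_mul_cancel₀ _ hx0.ne']
    linarith [hosc x y hx hy.symm]
  refine ⟨sSup lower, C + 1, by positivity, fun x hx => ?_⟩
  have hx0 : 0 < ‖x‖ ^ (2 - N) := Real.rpow_pos_of_pos (hr.trans_le hx) _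
  have hx1 : 0 < ‖x‖ ^ (1 - N) := Real.rpow_pos_of_pos (hr.trans_le hx) _
  have h₁ := (div_le_iff₀ hx0).1 (le_csSup ⟨_, hupper hx⟩ (hlower hx))
  have h₂ := (le_div_iff₀ hx0).1 (csSup_le ⟨_, hlower hx⟩ (hupper hx))
  rw [abs_le]
  constructor <;> linarith

end Laplacian

theorem lap_eq_laplacian {n : ℕ} {f : Euc n → ℝ} {x : Euc n} (hf : ContDiffAt ℝ 2 f x) :
    lap n f x = Δ f x := by
  have hd : DifferentiableAt ℝ (fderiv ℝ f) x :=
    (hf.fderiv_right (m := 1) (by norm_num)).differentiableAt (by simp)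
  rw [laplacian_eq_iteratedFDeriv_orthonormalBasis f (EuclideanSpace.basisFun (Fin n) ℝ)]
  refine Finset.sum_congr rfl fun i _ => ?_
  rw [iteratedFDeriv_two_apply]
  unfold pder
  rw [fderiv_clm_apply hd (differentiableAt_const _)]
  simp

theorem HarmonicOnSet.harmonicAt {n : ℕ} {u : Euc n → ℝ} {U : Set (Euc n)} (hU : IsOpen U)
    (hu : HarmonicOnSet n u U) {x : Euc n} (hx : x ∈ U) : HarmonicAt u x := by
  refine ⟨hu.1.contDiffAt (hU.mem_nhds hx), ?_⟩
  filter_upwards [hU.mem_nhds hx] with y hy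
  rw [← lap_eq_laplacian (hu.1.contDiffAt (hU.mem_nhds hy)), hu.2 y hy]
  rfl

/-- If `n ≥ 3`, `ρ > 0` and `u` is harmonic on `{|x| > ρ}` with
`u(x) → 1` as `|x| → ∞`, then there are `E ∈ ℝ` (the total energy) and `C > 0` with
`|u(x) − 1 − E|x|^{2−n}| ≤ C|x|^{1−n}` for `|x| ≥ 2ρ`. -/
theorem harmonic_expansion_total_energy
    (n : ℕ) (hn : 3 ≤ n) (ρ : ℝ) (hρ : 0 < ρ) (u : Euc n → ℝ)
    (hu : HarmonicOnSet n u {x : Euc n | ρ < ‖x‖})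
    (hlim : Filter.Tendsto u (Filter.comap (fun x : Euc n => ‖x‖) Filter.atTop)
      (nhds 1)) :
    ∃ E C : ℝ, 0 < C ∧ ∀ x : Euc n, 2*ρ ≤ ‖x‖ →
      |u x - 1 - E * ‖x‖ ^ ((2:ℝ) - n)| ≤ C * ‖x‖ ^ ((1:ℝ) - n) := by
  have hdim : Module.finrank ℝ (Euc n) = n := by simp
  have hharm (x : Euc n) (hx : 2 * ρ ≤ ‖x‖) : HarmonicAt (u - fun _ => 1) x :=
    (hu.harmonicAt (isOpen_lt continuous_const continuous_norm)
      (show ρ < ‖x‖ by linarith)).sub (harmonicAt_const 1)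
  have hlim' : Tendsto (u - fun _ => 1) (comap (fun x : Euc n => ‖x‖) atTop) (𝓝 0) := by
    simpa using! hlim.sub_const 1
  simpa only [hdim, Pi.sub_apply] using
    exists_abs_sub_mul_norm_rpow_le (by rwa [hdim]) (by positivity : 0 < 2 * ρ) hharm hlim'
end
end
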